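/- Let V_N be Haar-distributed on U(N), Z_N := det(I_N − V_N), and log Z_N defined as the value at x = 1 of the continuous branch of x ↦ log det(I_N − x V_N) on [0,1] vanishing at 0. Then as N → ∞, the ℝ²-valued random variable ( Re log Z_N / √((1/2) log N), Im log Z_N / √((1/2) log N) ) converges in distribution to a pair (𝒩_1, 𝒩_2) of two independent standard Gaussian random variables; i.e. its law converges weakly to the product of two standard Gaussian measures N(0,1) on ℝ². -/

import Mathlib

open MeasureTheory ProbabilityTheory Filter

noncomputable instance matrixMS {m n α : Type*} [MeasurableSpace α] :
    MeasurableSpace (Matrix m n α) := inferInstanceAs (MeasurableSpace (m → n → α))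

instance matrixBS {m n α : Type*} [Countable m] [Countable n] [TopologicalSpace α]
    [SecondCountableTopology α] [MeasurableSpace α] [BorelSpace α] :
    BorelSpace (Matrix m n α) := inferInstanceAs (BorelSpace (m → n → α))

instance borelSubtype {α : Type*} [TopologicalSpace α] [MeasurableSpace α] [BorelSpace α]
    (p : α → Prop) : BorelSpace (Subtype p) := Subtype.borelSpace {x | p x}

namespace KS
open Set Topology unitInterval

/-- Discrete approximation of the increment of the logarithm along a path. -/
noncomputable def stepLog (D : ℝ → ℂ) (n : ℕ) : ℂ :=
  ∑ k ∈ Finset.range n, Complex.log (D (((k + 1 : ℕ) : ℝ) / n) / D ((k : ℝ) / n))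

/-- `g` is a continuous branch of the logarithm of `D` on `[0,1]`, vanishing at `0`. -/
def IsLift (D : ℝ → ℂ) (g : ℝ → ℂ) : Prop :=
  ContinuousOn g (Icc 0 1) ∧ g 0 = 0 ∧ ∀ x ∈ Icc (0 : ℝ) 1, Complex.exp (g x) = D x

lemma IsLift.tendsto {D g : ℝ → ℂ} (h : IsLift D g) :
    Tendsto (stepLog D) atTop (𝓝 (g 1)) := by
  obtain ⟨hc, h0, he⟩ := h
  have hu := isCompact_Icc.uniformContinuousOn_of_continuous hc
  rw [Metric.uniformContinuousOn_iff] at hu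
  obtain ⟨δ, hδ, hu⟩ := hu 1 one_pos
  obtain ⟨n0, hn0⟩ := exists_nat_gt (1 / δ)
  refine tendsto_const_nhds.congr' ?_
  filter_upwards [eventually_ge_atTop (n0 + 1)] with n hn
  have hnpos : (0 : ℝ) < n := by
    have : 0 < n := by omega
    exact_mod_cast this
  have hstep : ∀ k ∈ Finset.range n,
      Complex.log (D (((k + 1 : ℕ) : ℝ) / n) / D ((k : ℝ) / n)) =
        g (((k + 1 : ℕ) : ℝ) / n) - g ((k : ℝ) / n) := by
    intro k hk
    have hk : k + 1 ≤ n := Finset.mem_range.mp hk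
    have hk' : ((k + 1 : ℕ) : ℝ) ≤ n := by exact_mod_cast hk
    have m1 : (((k + 1 : ℕ) : ℝ) / n) ∈ Icc (0 : ℝ) 1 :=
      ⟨by positivity, by rw [div_le_one hnpos]; exact hk'⟩
    have m2 : ((k : ℝ) / n) ∈ Icc (0 : ℝ) 1 :=
      ⟨by positivity, by rw [div_le_one hnpos]; push_cast at hk'; linarith⟩
    have hd := hu _ m1 _ m2 (by
      rw [Real.dist_eq, ← sub_div]
      have : (((k + 1 : ℕ) : ℝ) - k) = 1 := by push_cast; ring
      rw [this, abs_of_pos (by positivity), div_lt_iff₀ hnpos]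
      rw [div_lt_iff₀ hδ] at hn0
      have : (n0 : ℝ) ≤ n := by exact_mod_cast (by omega : n0 ≤ n)
      nlinarith)
    rw [← he _ m1, ← he _ m2, ← Complex.exp_sub]
    rw [dist_eq_norm] at hd
    have him := (Complex.abs_im_le_norm (g (((k + 1 : ℕ) : ℝ) / n) - g ((k : ℝ) / n))).trans hd.le
    rw [abs_le] at him
    have hpi := Real.pi_gt_three
    exact Complex.log_exp (by linarith) (by linarith)
  rw [stepLog, Finset.sum_congr rfl hstep]
  have := Finset.sum_range_sub (fun k : ℕ => g ((k : ℝ) / n)) n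
  rw [this]
  simp [h0, div_self hnpos.ne']

lemma IsLift.unique {D g g' : ℝ → ℂ} (h : IsLift D g) (h' : IsLift D g') : g 1 = g' 1 :=
  tendsto_nhds_unique h.tendsto h'.tendsto

lemma IsLift.congr {D D' g : ℝ → ℂ} (h : IsLift D g) (hD : ∀ x ∈ Icc (0 : ℝ) 1, D x = D' x) :
    IsLift D' g := ⟨h.1, h.2.1, fun x hx => by rw [h.2.2 x hx, hD x hx]⟩

/-- Lifting of a two-parameter nonvanishing family. -/
lemma exists_lift2 (H : ℝ → ℝ → ℂ)
    (hc : ContinuousOn (Function.uncurry H) (Icc 0 1 ×ˢ Icc 0 1))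
    (h0 : ∀ s ∈ Icc (0 : ℝ) 1, H 0 s = 1)
    (hne : ∀ x ∈ Icc (0 : ℝ) 1, ∀ s ∈ Icc (0 : ℝ) 1, H x s ≠ 0) :
    ∃ Γ : ℝ → ℝ → ℂ, ContinuousOn (Function.uncurry Γ) (Icc 0 1 ×ˢ Icc 0 1) ∧
      (∀ s ∈ Icc (0 : ℝ) 1, Γ 0 s = 0) ∧
      (∀ x ∈ Icc (0 : ℝ) 1, ∀ s ∈ Icc (0 : ℝ) 1, Complex.exp (Γ x s) = H x s) := by
  let Hc : C(I × I, {z : ℂ // z ≠ 0}) :=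
    ⟨fun p => ⟨H p.1 p.2, hne _ p.1.2 _ p.2.2⟩, by
      refine Continuous.subtype_mk ?_ _
      have : Continuous (fun p : I × I => ((p.1 : ℝ), (p.2 : ℝ))) := by fun_prop
      exact hc.comp_continuous this (fun p => ⟨p.1.2, p.2.2⟩)⟩
  let f0 : C(I, ℂ) := ContinuousMap.const _ 0
  have H0 : ∀ a, Hc (0, a) = (⟨_, (f0 a).exp_ne_zero⟩ : {z : ℂ // z ≠ 0}) := by
    intro a
    apply Subtype.ext
    simp [Hc, f0, h0 a a.2]
  let Γ := Complex.isCoveringMap_exp.liftHomotopy Hc f0 H0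
  refine ⟨fun x s => Γ (projIcc 0 1 zero_le_one x, projIcc 0 1 zero_le_one s), ?_, ?_, ?_⟩
  · refine Continuous.continuousOn ?_
    show Continuous fun p : ℝ × ℝ => Γ (projIcc 0 1 zero_le_one p.1, projIcc 0 1 zero_le_one p.2)
    refine Γ.continuous.comp ?_
    exact (continuous_projIcc.comp continuous_fst).prodMk (continuous_projIcc.comp continuous_snd)
  · intro s hs
    have := Complex.isCoveringMap_exp.liftHomotopy_zero Hc f0 H0 ⟨s, hs⟩
    simp only [projIcc_of_mem zero_le_one hs, projIcc_left]
    exact this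
  · intro x hx s hs
    have := congrFun (Complex.isCoveringMap_exp.liftHomotopy_lifts Hc f0 H0) (⟨x, hx⟩, ⟨s, hs⟩)
    have := congrArg Subtype.val this
    simp only [projIcc_of_mem zero_le_one hs, projIcc_of_mem zero_le_one hx]
    exact this

lemma exists_isLift (D : ℝ → ℂ) (hc : ContinuousOn D (Icc 0 1)) (h0 : D 0 = 1)
    (hne : ∀ x ∈ Icc (0 : ℝ) 1, D x ≠ 0) : ∃ g, IsLift D g := by
  obtain ⟨Γ, h1, h2, h3⟩ := exists_lift2 (fun x _ => D x)
    (hc.comp continuousOn_fst (fun p hp => hp.1)) (fun _ _ => h0) (fun x hx _ _ => hne x hx)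
  have m : (0 : ℝ) ∈ Icc (0 : ℝ) 1 := ⟨le_rfl, zero_le_one⟩
  refine ⟨fun x => Γ x 0, ?_, h2 0 m, fun x hx => h3 x hx 0 m⟩
  exact h1.comp (f := fun x : ℝ => (x, (0 : ℝ))) (by fun_prop) (fun x hx => ⟨hx, m⟩)

lemma lift_homotopy (H : ℝ → ℝ → ℂ)
    (hc : ContinuousOn (Function.uncurry H) (Icc 0 1 ×ˢ Icc 0 1))
    (h0 : ∀ s ∈ Icc (0 : ℝ) 1, H 0 s = 1)
    (hne : ∀ x ∈ Icc (0 : ℝ) 1, ∀ s ∈ Icc (0 : ℝ) 1, H x s ≠ 0)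
    (h1 : ∀ s ∈ Icc (0 : ℝ) 1, H 1 s = H 1 0)
    {g g' : ℝ → ℂ} (hg : IsLift (fun x => H x 0) g) (hg' : IsLift (fun x => H x 1) g') :
    g 1 = g' 1 := by
  obtain ⟨Γ, k1, k2, k3⟩ := exists_lift2 H hc h0 hne
  have m0 : (0 : ℝ) ∈ Icc (0 : ℝ) 1 := ⟨le_rfl, zero_le_one⟩
  have m1 : (1 : ℝ) ∈ Icc (0 : ℝ) 1 := ⟨zero_le_one, le_rfl⟩
  have a0 : IsLift (fun x => H x 0) (fun x => Γ x 0) :=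
    ⟨k1.comp (f := fun x : ℝ => (x, (0 : ℝ))) (by fun_prop) (fun x hx => ⟨hx, m0⟩),
      k2 0 m0, fun x hx => k3 x hx 0 m0⟩
  have a1 : IsLift (fun x => H x 1) (fun x => Γ x 1) :=
    ⟨k1.comp (f := fun x : ℝ => (x, (1 : ℝ))) (by fun_prop) (fun x hx => ⟨hx, m1⟩),
      k2 1 m1, fun x hx => k3 x hx 1 m1⟩
  have b : IsLift (fun _ => 1) (fun s => Γ 1 s - Γ 1 0) := by
    refine ⟨?_, by simp, fun s hs => ?_⟩
    · exact (k1.comp (f := fun s : ℝ => ((1 : ℝ), s)) (by fun_prop)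
        (fun x hx => ⟨m1, hx⟩)).sub continuousOn_const
    · rw [Complex.exp_sub, k3 1 m1 s hs, k3 1 m1 0 m0, h1 s hs, div_self (hne 1 m1 0 m0)]
  have b' : IsLift (fun _ => 1) (fun _ => (0 : ℂ)) :=
    ⟨continuousOn_const, rfl, fun _ _ => by simp⟩
  have e := b.unique b'
  rw [hg.unique a0, hg'.unique a1]
  exact (sub_eq_zero.mp e).symm

end KS

namespace KS
open Set Topology Matrix

abbrev UG (N : ℕ) : Type := ↥(Matrix.unitaryGroup (Fin N) ℂ)

/-- squared euclidean norm -/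
noncomputable def sq {N : ℕ} (v : Fin N → ℂ) : ℝ := ∑ i, ‖v i‖ ^ 2

lemma sq_nonneg' {N : ℕ} (v : Fin N → ℂ) : 0 ≤ sq v :=
  Finset.sum_nonneg fun _ _ => by positivity

lemma sq_pos {N : ℕ} {v : Fin N → ℂ} (h : v ≠ 0) : 0 < sq v := by
  obtain ⟨i, hi⟩ := Function.ne_iff.mp h
  refine Finset.sum_pos' (fun _ _ => by positivity) ⟨i, Finset.mem_univ _, ?_⟩
  have : 0 < ‖v i‖ := norm_pos_iff.mpr hi
  positivity

lemma sq_eq {N : ℕ} (v : Fin N → ℂ) : ((sq v : ℝ) : ℂ) = star v ⬝ᵥ v := by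
  simp [sq, dotProduct, Complex.conj_mul']

lemma sq_smul {N : ℕ} (c : ℂ) (v : Fin N → ℂ) : sq (c • v) = ‖c‖ ^ 2 * sq v := by
  simp [sq, mul_pow, Finset.mul_sum]

lemma sq_unitary {N : ℕ} {U : Matrix (Fin N) (Fin N) ℂ} (hU : U ∈ Matrix.unitaryGroup (Fin N) ℂ)
    (v : Fin N → ℂ) : sq (U *ᵥ v) = sq v := by
  have : ((sq (U *ᵥ v) : ℝ) : ℂ) = (sq v : ℝ) := by
    rw [sq_eq, sq_eq, star_mulVec, dotProduct_mulVec, vecMul_vecMul]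
    have := Matrix.mem_unitaryGroup_iff'.mp hU
    rw [star_eq_conjTranspose] at this
    rw [this, vecMul_one]
  exact_mod_cast this

/-- A matrix preserving the squared norm is unitary. -/
lemma unitary_of_sq {N : ℕ} {W : Matrix (Fin N) (Fin N) ℂ}
    (h : ∀ v, sq (W *ᵥ v) = sq v) : W ∈ Matrix.unitaryGroup (Fin N) ℂ := by
  rw [Matrix.mem_unitaryGroup_iff', star_eq_conjTranspose]
  have key : ∀ v, star v ⬝ᵥ ((Wᴴ * W - 1) *ᵥ v) = 0 := by
    intro v
    have : ((sq (W *ᵥ v) : ℝ) : ℂ) = (sq v : ℝ) := by rw [h]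
    rw [sq_eq, sq_eq, star_mulVec, dotProduct_mulVec, vecMul_vecMul] at this
    rw [sub_mulVec, dotProduct_sub, dotProduct_mulVec, this, one_mulVec, sub_self]
  have h2 : (Wᴴ * W - 1 : Matrix (Fin N) (Fin N) ℂ) = 0 := by
    have := (inner_map_self_eq_zero (Matrix.toEuclideanLin (Wᴴ * W - 1))).mp (by
      intro x
      have := key x.ofLp
      rw [← inner_conj_symm]
      rw [EuclideanSpace.inner_eq_star_dotProduct, dotProduct_comm]
      simp only [Matrix.ofLp_toLpLin, Matrix.toLin'_apply]
      rw [this]; simp)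
    exact (LinearEquiv.map_eq_zero_iff _).mp this
  exact sub_eq_zero.mp h2

lemma det_ne_zero_of_contraction {N : ℕ} {A : Matrix (Fin N) (Fin N) ℂ}
    (hA : ∀ v, sq (A *ᵥ v) ≤ sq v) {x : ℝ} (h0 : 0 ≤ x) (h1 : x < 1) :
    Matrix.det (1 - (x : ℂ) • A) ≠ 0 := by
  intro hdet
  obtain ⟨v, hv, hv'⟩ := Matrix.exists_mulVec_eq_zero_iff.mpr hdet
  rw [sub_mulVec, one_mulVec, smul_mulVec, sub_eq_zero] at hv'
  have h2 : sq v = x ^ 2 * sq (A *ᵥ v) := by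
    conv_lhs => rw [hv']
    rw [sq_smul]; simp
  have := hA v
  have hp := sq_pos hv
  have hx : x ^ 2 < 1 := by nlinarith
  have e1 := mul_le_mul_of_nonneg_left this (_root_.sq_nonneg x)
  have e2 := mul_lt_mul_of_pos_right hx hp
  linarith

/-- The determinant path. -/
noncomputable def dpath {N : ℕ} (A : Matrix (Fin N) (Fin N) ℂ) (x : ℝ) : ℂ :=
  Matrix.det (1 - (x : ℂ) • A)

/-- canonical logarithm -/
noncomputable def Lfun {N : ℕ} (A : Matrix (Fin N) (Fin N) ℂ) : ℂ :=
  limUnder atTop (stepLog (dpath A))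

lemma Lfun_eq {N : ℕ} {A : Matrix (Fin N) (Fin N) ℂ} {g : ℝ → ℂ} (h : IsLift (dpath A) g) :
    Lfun A = g 1 := h.tendsto.limUnder_eq

lemma exists_branch {N : ℕ} {A : Matrix (Fin N) (Fin N) ℂ}
    (hA : ∀ v, sq (A *ᵥ v) ≤ sq v) (hd : Matrix.det (1 - A) ≠ 0) :
    ∃ g, IsLift (dpath A) g := by
  refine exists_isLift _ ?_ (by simp [dpath]) ?_
  · unfold dpath
    exact (Continuous.matrix_det (by fun_prop)).continuousOn
  · intro x hx
    rcases hx.2.lt_or_eq with h | h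
    · exact det_ne_zero_of_contraction hA hx.1 h
    · subst h; simpa [dpath] using hd

/-- Schur-type reduction. -/
noncomputable def Wmat {N : ℕ} (U : Matrix (Fin (N + 1)) (Fin (N + 1)) ℂ) (s : ℝ) :
    Matrix (Fin N) (Fin N) ℂ :=
  Matrix.of fun i j => U i.succ j.succ + s * U i.succ 0 * U 0 j.succ / (1 - s * U 0 0)

lemma Wmat_sq {N : ℕ} {U : Matrix (Fin (N + 1)) (Fin (N + 1)) ℂ}
    (hU : U ∈ Matrix.unitaryGroup (Fin (N + 1)) ℂ) {s : ℝ} (hs : 1 - s * U 0 0 ≠ 0)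
    (v : Fin N → ℂ) : ∃ η : ℂ, ‖η‖ ^ 2 + sq (Wmat U s *ᵥ v) = s ^ 2 * ‖η‖ ^ 2 + sq v := by
  let η : ℂ := (∑ j, U 0 j.succ * v j) / (1 - s * U 0 0)
  let ξ : Fin (N + 1) → ℂ := Fin.cons (s * η) v
  have hη : (1 - s * U 0 0) * η = ∑ j, U 0 j.succ * v j := by
    simp only [η]; field_simp
  have h1 : U *ᵥ ξ = Fin.cons η (Wmat U s *ᵥ v) := by
    funext i
    refine Fin.cases ?_ (fun i => ?_) i
    · simp only [mulVec, dotProduct, Fin.sum_univ_succ, ξ, Fin.cons_zero, Fin.cons_succ]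
      linear_combination -hη
    · simp only [mulVec, dotProduct, Fin.sum_univ_succ, ξ, Fin.cons_zero, Fin.cons_succ, Wmat,
        Matrix.of_apply, add_mul, Finset.sum_add_distrib]
      have : ∑ j, (s : ℂ) * U i.succ 0 * U 0 j.succ / (1 - s * U 0 0) * v j
          = s * U i.succ 0 * η := by
        simp only [η]
        rw [Finset.sum_div, Finset.mul_sum]
        refine Finset.sum_congr rfl fun j _ => by ring
      rw [this]; ring
  refine ⟨η, ?_⟩
  have h2 := sq_unitary hU ξ
  rw [h1] at h2
  simp only [sq, Fin.sum_univ_succ, ξ, Fin.cons_zero, Fin.cons_succ, norm_mul, mul_pow,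
    Complex.norm_real, Real.norm_eq_abs, sq_abs] at h2
  simpa [sq] using h2

lemma Wmat_contraction {N : ℕ} {U : Matrix (Fin (N + 1)) (Fin (N + 1)) ℂ}
    (hU : U ∈ Matrix.unitaryGroup (Fin (N + 1)) ℂ) {s : ℝ} (hs : 1 - s * U 0 0 ≠ 0)
    (h0 : 0 ≤ s) (h1 : s ≤ 1)
    (v : Fin N → ℂ) : sq (Wmat U s *ᵥ v) ≤ sq v := by
  obtain ⟨η, h⟩ := Wmat_sq hU hs v
  have : s ^ 2 ≤ 1 := by nlinarith
  nlinarith [_root_.sq_nonneg ‖η‖]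

lemma Wmat_unitary {N : ℕ} {U : Matrix (Fin (N + 1)) (Fin (N + 1)) ℂ}
    (hU : U ∈ Matrix.unitaryGroup (Fin (N + 1)) ℂ) (hs : 1 - U 0 0 ≠ 0) :
    Wmat U 1 ∈ Matrix.unitaryGroup (Fin N) ℂ := by
  refine unitary_of_sq fun v => ?_
  obtain ⟨η, h⟩ := Wmat_sq hU (s := 1) (by simpa using hs) v
  linarith

lemma det_schur {N : ℕ} (U : Matrix (Fin (N + 1)) (Fin (N + 1)) ℂ) {s : ℝ}
    (hs : 1 - s * U 0 0 ≠ 0) :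
    dpath U s = (1 - s * U 0 0) * Matrix.det (1 - (s : ℂ) • Wmat U s) := by
  let M := 1 - (s : ℂ) • U
  have hM : (M.submatrix (finSuccEquiv N).symm (finSuccEquiv N).symm).det = M.det :=
    Matrix.det_submatrix_equiv_self _ _
  let e : Unit ⊕ Fin N ≃ Fin (N + 1) :=
    (Equiv.sumComm _ _).trans ((Equiv.optionEquivSumPUnit (Fin N)).symm.trans (finSuccEquiv N).symm)
  have he1 : e (Sum.inl ()) = 0 := by simp [e]
  have he2 : ∀ i, e (Sum.inr i) = i.succ := by simp [e]
  have h1 : M.submatrix e e = Matrix.fromBlocks (Matrix.of fun _ _ => 1 - s * U 0 0)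
      (Matrix.of fun _ j => - (s * U 0 j.succ)) (Matrix.of fun i _ => - (s * U i.succ 0))
      (1 - (s : ℂ) • U.submatrix Fin.succ Fin.succ) := by
    ext i j
    rcases i with i | i <;> rcases j with j | j
    · simp [he1, M]
    · simp [he1, he2, M, Matrix.one_apply, (Fin.succ_ne_zero _).symm]
    · simp [he1, he2, M, Matrix.one_apply]
    · simp [he2, M, Matrix.one_apply]
  have h2 : M.det = (M.submatrix e e).det := (Matrix.det_submatrix_equiv_self _ _).symm
  have hu : IsUnit (Matrix.of fun (_ _ : Unit) => (1 - s * U 0 0 : ℂ)) := by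
    rw [Matrix.isUnit_iff_isUnit_det]; simpa using hs
  let _ := hu.invertible
  show M.det = _
  rw [h2, h1, Matrix.det_fromBlocks₁₁]
  have hinv : ∀ a b, (⅟(Matrix.of fun (_ _ : Unit) => (1 - s * U 0 0 : ℂ))) a b
      = (1 - s * U 0 0)⁻¹ := by
    intro a b
    rw [Matrix.invOf_eq_nonsing_inv, Matrix.inv_def, Matrix.adjugate_subsingleton]
    simp [Subsingleton.elim a b]
  congr 1
  · simp
  · congr 1
    ext i j
    simp only [Matrix.sub_apply, Matrix.mul_apply, Matrix.smul_apply, Wmat, Matrix.of_apply,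
      Finset.univ_unique, Finset.sum_singleton, hinv, smul_eq_mul, Matrix.submatrix_apply]
    field_simp
    ring

lemma U00_norm {N : ℕ} {U : Matrix (Fin (N + 1)) (Fin (N + 1)) ℂ}
    (hU : U ∈ Matrix.unitaryGroup (Fin (N + 1)) ℂ) : ‖U 0 0‖ ≤ 1 :=
  entry_norm_bound_of_unitary hU 0 0

lemma U00_ne {N : ℕ} {U : Matrix (Fin (N + 1)) (Fin (N + 1)) ℂ}
    (hU : U ∈ Matrix.unitaryGroup (Fin (N + 1)) ℂ) (hd : Matrix.det (1 - U) ≠ 0) : U 0 0 ≠ 1 := by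
  intro h
  apply hd
  rw [← Matrix.exists_mulVec_eq_zero_iff]
  refine ⟨Pi.single 0 1, by simp, ?_⟩
  have h1 := sq_unitary hU (Pi.single 0 1)
  simp only [sq, Fin.sum_univ_succ, Matrix.mulVec_single_one, Matrix.col_apply, h] at h1
  simp at h1
  have h3 : ∀ i : Fin N, U i.succ 0 = 0 := by
    rw [Finset.sum_eq_zero_iff_of_nonneg (fun _ _ => by positivity)] at h1
    intro i
    simpa using h1 i (Finset.mem_univ _)
  funext i
  refine Fin.cases ?_ (fun i => ?_) i
  · simp [h]
  · simp [h3, Matrix.one_apply]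

lemma re_pos {z : ℂ} (hz : ‖z‖ ≤ 1) (h1 : z ≠ 1) {s : ℝ} (h0s : 0 ≤ s) (hs1 : s ≤ 1) :
    0 < (1 - s * z).re := by
  have hre : z.re ≤ 1 := (Complex.re_le_norm z).trans hz
  have hre' : z.re < 1 := by
    rcases hre.lt_or_eq with h | h
    · exact h
    · exfalso
      apply h1
      have : ‖z‖ ^ 2 ≤ 1 := by nlinarith [norm_nonneg z]
      rw [← Complex.normSq_eq_norm_sq, Complex.normSq_apply, h] at this
      have him : z.im = 0 := by nlinarith
      exact Complex.ext (by simpa using h) (by simpa using him)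
  simp only [Complex.sub_re, Complex.one_re, Complex.mul_re, Complex.ofReal_re, Complex.ofReal_im,
    zero_mul, sub_zero]
  rcases h0s.eq_or_lt with h | h
  · rw [← h]; simp
  · have := mul_pos h (sub_pos.mpr hre')
    nlinarith

lemma Lfun_schur {N : ℕ} {U : Matrix (Fin (N + 1)) (Fin (N + 1)) ℂ}
    (hU : U ∈ Matrix.unitaryGroup (Fin (N + 1)) ℂ) (hd : Matrix.det (1 - U) ≠ 0) :
    Lfun U = Complex.log (1 - U 0 0) + Lfun (Wmat U 1) := by
  have hne := U00_ne hU hd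
  have hn := U00_norm hU
  have hre : ∀ s ∈ Icc (0 : ℝ) 1, 0 < (1 - s * U 0 0).re := fun s hs => re_pos hn hne hs.1 hs.2
  have hnz : ∀ s ∈ Icc (0 : ℝ) 1, (1 - s * U 0 0) ≠ 0 := by
    intro s hs h
    have := hre s hs
    rw [h] at this; simp at this
  have m0 : (0 : ℝ) ∈ Icc (0 : ℝ) 1 := ⟨le_rfl, zero_le_one⟩
  have m1 : (1 : ℝ) ∈ Icc (0 : ℝ) 1 := ⟨zero_le_one, le_rfl⟩
  obtain ⟨g, hg⟩ := exists_branch (fun v => (sq_unitary hU v).le) hd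
  have hdW : Matrix.det (1 - Wmat U 1) ≠ 0 := by
    have := det_schur U (hnz 1 m1)
    intro h
    apply hd
    simpa [dpath, h] using this
  obtain ⟨g', hg'⟩ := exists_branch (fun v => Wmat_contraction hU (hnz 1 m1) zero_le_one le_rfl v) hdW
  rw [Lfun_eq hg, Lfun_eq hg']
  have hmem : ∀ x ∈ Icc (0 : ℝ) 1, ∀ s ∈ Icc (0 : ℝ) 1, s + (1 - s) * x ∈ Icc (0 : ℝ) 1 := by
    intro x hx s hs
    constructor
    · have := mul_nonneg (sub_nonneg.mpr hs.2) hx.1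
      linarith [hs.1]
    · nlinarith [hx.2, hs.2, hs.1]
  have key := lift_homotopy (fun x s => Matrix.det (1 - (x : ℂ) • Wmat U (s + (1 - s) * x)))
    (g := fun x => g x - Complex.log (1 - x * U 0 0)) (g' := g') ?_ ?_ ?_ ?_ ?_ ?_
  · simp only [Complex.ofReal_one, one_mul] at key
    rw [← key]; ring
  · intro p hp
    have hden := hnz _ (hmem p.1 hp.1 p.2 hp.2)
    refine ContinuousAt.continuousWithinAt ?_
    simp only [Function.uncurry_def]
    have : ContinuousAt (fun p : ℝ × ℝ =>
        (1 - (p.1 : ℂ) • Wmat U (p.2 + (1 - p.2) * p.1) : Matrix (Fin N) (Fin N) ℂ)) p := by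
      refine ContinuousAt.sub continuousAt_const ?_
      refine ContinuousAt.fun_smul (f := fun p : ℝ × ℝ => (p.1 : ℂ)) (by fun_prop) ?_
      unfold Wmat
      refine continuousAt_pi.mpr fun i => continuousAt_pi.mpr fun j => ?_
      simp only [Matrix.of_apply]
      refine ContinuousAt.add continuousAt_const (ContinuousAt.div ?_ ?_ hden)
      · fun_prop
      · fun_prop
    exact ContinuousAt.comp (g := Matrix.det) (Continuous.matrix_det continuous_id).continuousAt this
  · intro s _; simp
  · intro x hx s hs
    rcases hx.2.lt_or_eq with h | h
    · have hm := hmem x hx s hs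
      exact det_ne_zero_of_contraction (Wmat_contraction hU (hnz _ hm) hm.1 hm.2) hx.1 h
    · subst h; simpa using hdW
  · intro s _; simp
  · refine ⟨hg.1.sub ?_, by simp [hg.2.1], fun x hx => ?_⟩
    · refine ContinuousOn.clog (by fun_prop) fun x hx => Or.inl (hre x hx)
    · rw [Complex.exp_sub, hg.2.2 x hx, Complex.exp_log (hnz x hx), det_schur U (hnz x hx),
        mul_div_cancel_left₀ _ (hnz x hx)]
      simp
  · refine hg'.congr fun x hx => ?_
    simp [dpath]

/-- Block embedding `V ↦ 1 ⊕ V`. -/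
noncomputable def emb {N : ℕ} (V : Matrix (Fin N) (Fin N) ℂ) :
    Matrix (Fin (N + 1)) (Fin (N + 1)) ℂ :=
  Matrix.of fun i j => Fin.cases (motive := fun _ => ℂ) (Fin.cases (motive := fun _ => ℂ) 1 (fun _ => 0) j)
    (fun i' => Fin.cases (motive := fun _ => ℂ) 0 (fun j' => V i' j') j) i

@[simp] lemma emb_00 {N : ℕ} (V : Matrix (Fin N) (Fin N) ℂ) : emb V 0 0 = 1 := rfl
@[simp] lemma emb_0s {N : ℕ} (V : Matrix (Fin N) (Fin N) ℂ) (j : Fin N) : emb V 0 j.succ = 0 := rfl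
@[simp] lemma emb_s0 {N : ℕ} (V : Matrix (Fin N) (Fin N) ℂ) (j : Fin N) : emb V j.succ 0 = 0 := rfl
@[simp] lemma emb_ss {N : ℕ} (V : Matrix (Fin N) (Fin N) ℂ) (i j : Fin N) :
    emb V i.succ j.succ = V i j := rfl

lemma emb_unitary {N : ℕ} {V : Matrix (Fin N) (Fin N) ℂ}
    (hV : V ∈ Matrix.unitaryGroup (Fin N) ℂ) : emb V ∈ Matrix.unitaryGroup (Fin (N + 1)) ℂ := by
  refine unitary_of_sq fun v => ?_
  have h := sq_unitary hV (fun j => v j.succ)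
  simp only [sq, mulVec, dotProduct, Fin.sum_univ_succ, emb_00, emb_0s, emb_s0, emb_ss] at h ⊢
  simp [h]

lemma Wmat_mul_emb {N : ℕ} (U : Matrix (Fin (N + 1)) (Fin (N + 1)) ℂ)
    (V : Matrix (Fin N) (Fin N) ℂ) : Wmat (U * emb V) 1 = Wmat U 1 * V := by
  ext i j
  simp only [Wmat, Matrix.of_apply, Matrix.mul_apply, Fin.sum_univ_succ, emb_00, emb_0s, emb_s0,
    emb_ss]
  simp only [mul_zero, Finset.sum_const_zero, add_zero, zero_add, mul_one, add_mul,
    Finset.sum_add_distrib]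
  congr 1
  rw [Finset.mul_sum, Finset.sum_div]
  exact Finset.sum_congr rfl fun k _ => by ring

lemma mul_emb_00 {N : ℕ} (U : Matrix (Fin (N + 1)) (Fin (N + 1)) ℂ)
    (V : Matrix (Fin N) (Fin N) ℂ) : (U * emb V) 0 0 = U 0 0 := by
  simp [Matrix.mul_apply, Fin.sum_univ_succ]

end KS

namespace KS
open Set Topology Matrix

lemma dpath_continuous {N : ℕ} (x : ℝ) :
    Continuous (fun U : UG N => dpath (U : Matrix (Fin N) (Fin N) ℂ) x) := by
  unfold dpath
  exact Continuous.matrix_det (by fun_prop)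

lemma Lfun_measurable {N : ℕ} :
    Measurable (fun U : UG N => Lfun (U : Matrix (Fin N) (Fin N) ℂ)) := by
  unfold Lfun
  refine (StronglyMeasurable.limUnder fun n => Measurable.stronglyMeasurable ?_).measurable
  unfold stepLog
  refine Finset.measurable_fun_sum _ fun k _ => ?_
  exact ((dpath_continuous _).measurable.div (dpath_continuous _).measurable).clog

lemma entry_continuous {N : ℕ} (i j : Fin N) :
    Continuous (fun U : UG N => (U : Matrix (Fin N) (Fin N) ℂ) i j) :=
  (continuous_apply j).comp ((continuous_apply i).comp continuous_subtype_val)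

lemma entry_measurable {N : ℕ} (i j : Fin N) :
    Measurable (fun U : UG N => (U : Matrix (Fin N) (Fin N) ℂ) i j) :=
  (entry_continuous i j).measurable

instance compactUG (N : ℕ) : CompactSpace (UG N) := by
  refine isCompact_iff_compactSpace (s := (Matrix.unitaryGroup (Fin N) ℂ :
    Set (Matrix (Fin N) (Fin N) ℂ))).mp ?_
  have hcl : IsClosed (Matrix.unitaryGroup (Fin N) ℂ : Set (Matrix (Fin N) (Fin N) ℂ)) :=
    isClosed_unitary
  have hK : IsCompact (Set.pi univ fun _ : Fin N => Set.pi univ fun _ : Fin N =>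
      Metric.closedBall (0 : ℂ) 1) :=
    isCompact_univ_pi fun _ => isCompact_univ_pi fun _ => isCompact_closedBall _ _
  refine IsCompact.of_isClosed_subset hK hcl ?_
  intro U hU i _ j _
  simpa using entry_norm_bound_of_unitary hU i j

instance scUG (N : ℕ) : SecondCountableTopology (UG N) :=
  have : SecondCountableTopology (Matrix (Fin N) (Fin N) ℂ) :=
    inferInstanceAs (SecondCountableTopology (Fin N → Fin N → ℂ))
  TopologicalSpace.Subtype.secondCountableTopology _

lemma rightInv {N : ℕ} (μ : Measure (UG N)) [μ.IsHaarMeasure] [IsProbabilityMeasure μ] :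
    μ.IsMulRightInvariant := by
  constructor
  intro g
  have : IsProbabilityMeasure (Measure.map (fun x => x * g) μ) :=
    Measure.isProbabilityMeasure_map (by fun_prop)
  have : (Measure.map (fun x => x * g) μ).IsHaarMeasure := inferInstance
  exact Measure.isHaarMeasure_eq_of_isProbabilityMeasure _ _

/-- Bounded measurable functions are integrable. -/
lemma integrable_bdd {X : Type*} [MeasurableSpace X] (μ : Measure X) [IsProbabilityMeasure μ]
    {f : X → ℂ} (hf : Measurable f) (C : ℝ) (h : ∀ x, ‖f x‖ ≤ C) : Integrable f μ :=
  Integrable.of_bound hf.aestronglyMeasurable C (ae_of_all _ h)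

/-- `exp (i ⟨t, z⟩)` -/
noncomputable def ch (t z : ℂ) : ℂ := Complex.exp ((t.re * z.re + t.im * z.im : ℝ) * Complex.I)

lemma ch_norm (t z : ℂ) : ‖ch t z‖ = 1 := Complex.norm_exp_ofReal_mul_I _

lemma ch_add (t z w : ℂ) : ch t (z + w) = ch t z * ch t w := by
  unfold ch
  rw [← Complex.exp_add]
  congr 1
  simp only [Complex.add_re, Complex.add_im]
  push_cast; ring

lemma ch_continuous (t : ℂ) : Continuous (ch t) := by
  unfold ch; fun_prop

/-- The characteristic function of the logarithm. -/
noncomputable def phi {N : ℕ} (μ : Measure (UG N)) (t : ℂ) : ℂ :=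
  ∫ U : UG N, ch t (Lfun (U : Matrix (Fin N) (Fin N) ℂ)) ∂μ

/-- The characteristic function of one factor. -/
noncomputable def psi {N : ℕ} (μ : Measure (UG (N + 1))) (t : ℂ) : ℂ :=
  ∫ U : UG (N + 1), ch t (Complex.log (1 - (U : Matrix (Fin (N + 1)) (Fin (N + 1)) ℂ) 0 0)) ∂μ

noncomputable def embU {N : ℕ} (V : UG N) : UG (N + 1) := ⟨emb V.1, emb_unitary V.2⟩

lemma embU_continuous {N : ℕ} : Continuous (embU : UG N → UG (N + 1)) := by
  refine Continuous.subtype_mk ?_ _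
  refine continuous_pi fun i => continuous_pi fun j => ?_
  refine Fin.cases ?_ (fun i => ?_) i <;> refine Fin.cases ?_ (fun j => ?_) j
  · exact continuous_const
  · exact continuous_const
  · exact continuous_const
  · exact entry_continuous i j

lemma phi_succ {N : ℕ} (μ : Measure (UG N)) [μ.IsHaarMeasure] [IsProbabilityMeasure μ]
    (ν : Measure (UG (N + 1))) [ν.IsHaarMeasure] [IsProbabilityMeasure ν]
    (hgood : ∀ᵐ U : UG (N + 1) ∂ν, Matrix.det (1 - (U : Matrix (Fin (N + 1)) (Fin (N + 1)) ℂ)) ≠ 0) (t : ℂ) :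
    phi ν t = psi ν t * phi μ t := by
  have := rightInv ν
  obtain ⟨F, hFd⟩ : ∃ F : UG (N + 1) → ℂ,
      F = fun U : UG (N + 1) => ch t (Lfun (U : Matrix (Fin (N + 1)) (Fin (N + 1)) ℂ)) := ⟨_, rfl⟩
  have hF : Measurable F := by
    rw [hFd]; exact (ch_continuous t).measurable.comp Lfun_measurable
  have hF1 : ∀ U, ‖F U‖ ≤ 1 := by
    intro U; rw [hFd]; exact (ch_norm _ _).le
  have hFi : ∀ g : UG (N + 1), ∫ U, F (U * g) ∂ν = ∫ U, F U ∂ν := fun g =>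
    integral_mul_right_eq_self F g
  have hmeas : Measurable fun p : UG N × UG (N + 1) => F (p.2 * embU p.1) := by
    refine hF.comp ?_
    have : Continuous fun p : UG N × UG (N + 1) => p.2 * embU p.1 :=
      continuous_snd.mul (embU_continuous.comp continuous_fst)
    exact this.measurable
  have hinteg : Integrable (Function.uncurry fun (V : UG N) (U : UG (N + 1)) => F (U * embU V))
      (μ.prod ν) := integrable_bdd _ hmeas 1 fun p => hF1 _
  have h1 : phi ν t = ∫ V : UG N, ∫ U, F (U * embU V) ∂ν ∂μ := by
    simp only [hFi]; simp [phi, hFd]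
  rw [h1, integral_integral_swap hinteg]
  -- the set of good points for almost every pair
  have hae : ∀ᵐ U : UG (N + 1) ∂ν, ∀ᵐ V : UG N ∂μ,
      Matrix.det (1 - ((U * embU V : UG (N + 1)) : Matrix (Fin (N + 1)) (Fin (N + 1)) ℂ)) ≠ 0 := by
    have hset : MeasurableSet {p : UG N × UG (N + 1) |
        Matrix.det (1 - ((p.2 * embU p.1 : UG (N + 1)) :
          Matrix (Fin (N + 1)) (Fin (N + 1)) ℂ)) ≠ 0} := by
      have hc : Continuous fun p : UG N × UG (N + 1) =>
          Matrix.det (1 - ((p.2 * embU p.1 : UG (N + 1)) :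
            Matrix (Fin (N + 1)) (Fin (N + 1)) ℂ)) := by
        refine Continuous.matrix_det (continuous_const.sub (continuous_subtype_val.comp ?_))
        exact continuous_snd.mul (embU_continuous.comp continuous_fst)
      exact (isOpen_ne_fun hc continuous_const).measurableSet
    have hswap : ∀ᵐ V : UG N ∂μ, ∀ᵐ U : UG (N + 1) ∂ν, Matrix.det (1 - ((U * embU V : UG (N + 1)) :
        Matrix (Fin (N + 1)) (Fin (N + 1)) ℂ)) ≠ 0 := by
      refine ae_of_all _ fun V => ?_
      have hq := (measurePreserving_mul_right ν (embU V)).quasiMeasurePreserving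
      exact hq.ae hgood
    exact Measure.ae_ae_comm hset |>.mp hswap
  have h2 : ∀ᵐ U : UG (N + 1) ∂ν, ∫ V, F (U * embU V) ∂μ =
      ch t (Complex.log (1 - (U : Matrix (Fin (N + 1)) (Fin (N + 1)) ℂ) 0 0)) * phi μ t := by
    filter_upwards [hae, hgood] with U hU hU'
    have hW := Wmat_unitary U.2 (sub_ne_zero.mpr (U00_ne U.2 hU').symm)
    let W : UG N := ⟨_, hW⟩
    have h3 : ∫ V, F (U * embU V) ∂μ =
        ∫ V : UG N, ch t (Complex.log (1 - (U : Matrix (Fin (N + 1)) (Fin (N + 1)) ℂ) 0 0)) *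
          ch t (Lfun ((W * V : UG N) : Matrix (Fin N) (Fin N) ℂ)) ∂μ := by
      refine integral_congr_ae ?_
      filter_upwards [hU] with V hV
      simp only [hFd]
      rw [Lfun_schur (U * embU V).2 hV, ch_add]
      have e1 : ((U * embU V : UG (N + 1)) : Matrix (Fin (N + 1)) (Fin (N + 1)) ℂ)
        = U.1 * emb V.1 := rfl
      rw [e1, Wmat_mul_emb, mul_emb_00]
      rfl
    rw [h3, integral_const_mul]
    congr 1
    exact integral_mul_left_eq_self
      (fun V : UG N => ch t (Lfun (V : Matrix (Fin N) (Fin N) ℂ))) W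
  rw [integral_congr_ae h2, integral_mul_const]
  rfl

lemma phi_zero (μ : Measure (UG 0)) [IsProbabilityMeasure μ] (t : ℂ) : phi μ t = 1 := by
  have : ∀ U : UG 0, Lfun (U : Matrix (Fin 0) (Fin 0) ℂ) = 0 := by
    intro U
    have : IsLift (dpath (U : Matrix (Fin 0) (Fin 0) ℂ)) (fun _ => 0) :=
      ⟨continuousOn_const, rfl, fun x _ => by simp [dpath]⟩
    exact Lfun_eq this
  simp [phi, this, ch]

end KS

namespace KS
open Set Topology Matrix

lemma int_cont {N : ℕ} (ν : Measure (UG N)) [IsProbabilityMeasure ν] {E : Type*}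
    [NormedAddCommGroup E] {f : UG N → E}
    (hf : Continuous f) : Integrable f ν :=
  hf.integrable_of_hasCompactSupport (HasCompactSupport.of_compactSpace f)

/-- Row permutation matrices. -/
noncomputable def permU {N : ℕ} (σ : Equiv.Perm (Fin N)) : UG N :=
  ⟨Matrix.of fun i j => if σ i = j then 1 else 0, by
    refine unitary_of_sq fun v => ?_
    have : (Matrix.of fun i j => if σ i = j then (1 : ℂ) else 0) *ᵥ v = v ∘ σ := by
      funext i
      simp [mulVec, dotProduct]
    rw [this]
    exact Equiv.sum_comp σ (fun i => ‖v i‖ ^ 2)⟩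

lemma permU_mul {N : ℕ} (σ : Equiv.Perm (Fin N)) (U : UG N) (i j : Fin N) :
    ((permU σ * U : UG N) : Matrix (Fin N) (Fin N) ℂ) i j
      = (U : Matrix (Fin N) (Fin N) ℂ) (σ i) j := by
  show ((permU σ).1 * U.1) i j = _
  simp [permU, Matrix.mul_apply]

/-- Multiplication by the scalar `i`. -/
noncomputable def iU (N : ℕ) : UG N :=
  ⟨Complex.I • 1, by
    refine unitary_of_sq fun v => ?_
    rw [smul_mulVec, one_mulVec, sq_smul]; simp⟩

lemma iU_mul {N : ℕ} (U : UG N) (i j : Fin N) :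
    ((iU N * U : UG N) : Matrix (Fin N) (Fin N) ℂ) i j
      = Complex.I * (U : Matrix (Fin N) (Fin N) ℂ) i j := by
  show ((iU N).1 * U.1) i j = _
  simp [iU]

noncomputable def hadMat (N : ℕ) : Matrix (Fin (N + 2)) (Fin (N + 2)) ℂ :=
  Matrix.of (Fin.cons (Fin.cons ((√2)⁻¹ : ℝ) (Fin.cons ((√2)⁻¹ : ℝ) 0))
    (Fin.cons (Fin.cons ((√2)⁻¹ : ℝ) (Fin.cons (-((√2)⁻¹ : ℝ)) 0))
      (fun i => Fin.cons 0 (Fin.cons 0 (Pi.single i 1)))))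

lemma hadMat_mul (N : ℕ) (v : Fin (N + 2) → ℂ) :
    (hadMat N *ᵥ v) = Fin.cons (((√2)⁻¹ : ℝ) * (v 0 + v 1))
      (Fin.cons (((√2)⁻¹ : ℝ) * (v 0 - v 1)) (fun i => v i.succ.succ)) := by
  funext i
  refine Fin.cases ?_ (fun i => ?_) i
  · simp [hadMat, mulVec, dotProduct, Fin.sum_univ_succ]; ring
  · refine Fin.cases ?_ (fun i => ?_) i
    · simp [hadMat, mulVec, dotProduct, Fin.sum_univ_succ]; ring
    · simp [hadMat, mulVec, dotProduct, Fin.sum_univ_succ, Pi.single_apply]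

lemma parallelogram (a b : ℂ) : ‖a + b‖ ^ 2 + ‖a - b‖ ^ 2 = 2 * (‖a‖ ^ 2 + ‖b‖ ^ 2) := by
  have := parallelogram_law_with_norm ℝ a b
  nlinarith

noncomputable def hadU (N : ℕ) : UG (N + 2) :=
  ⟨hadMat N, by
    refine unitary_of_sq fun v => ?_
    rw [hadMat_mul]
    have h := parallelogram (v 0) (v 1)
    have h2 : ((√2)⁻¹ : ℝ) ^ 2 = 1 / 2 := by rw [inv_pow, Real.sq_sqrt (by norm_num)]; norm_num
    simp only [sq, Fin.sum_univ_succ, Fin.cons_zero, Fin.cons_succ, norm_mul, mul_pow,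
      Complex.norm_real, Real.norm_eq_abs, sq_abs, h2]
    have e : v (Fin.succ 0) = v 1 := rfl
    rw [e]
    linarith⟩

lemma hadU_mul0 {N : ℕ} (U : UG (N + 2)) :
    ((hadU N * U : UG (N + 2)) : Matrix (Fin (N + 2)) (Fin (N + 2)) ℂ) 0 0
      = ((√2)⁻¹ : ℝ) * (U.1 0 0 + U.1 1 0) := by
  have := congrFun (hadMat_mul N (fun j => U.1 j 0)) 0
  exact this

lemma hadU_mul1 {N : ℕ} (U : UG (N + 2)) :
    ((hadU N * U : UG (N + 2)) : Matrix (Fin (N + 2)) (Fin (N + 2)) ℂ) 1 0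
      = ((√2)⁻¹ : ℝ) * (U.1 0 0 - U.1 1 0) := by
  have := congrFun (hadMat_mul N (fun j => U.1 j 0)) 1
  exact this

lemma col_sum {N : ℕ} (U : UG (N + 1)) : ∑ j, ‖U.1 j 0‖ ^ 2 = 1 := by
  have h1 := sq_unitary U.2 (Pi.single 0 1)
  simp only [sq, Matrix.mulVec_single_one, Matrix.col_apply] at h1
  rw [h1, Finset.sum_eq_single 0]
  · simp
  · intro b _ hb; simp [hb]
  · simp

section
variable {N : ℕ} (ν : Measure (UG (N + 1))) [ν.IsHaarMeasure] [IsProbabilityMeasure ν]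

lemma norm_cont (j : Fin (N + 1)) : Continuous fun U : UG (N + 1) => ‖U.1 j 0‖ :=
  (entry_continuous j 0).norm

lemma moment_pow (k : ℕ) (j : Fin (N + 1)) :
    ∫ U : UG (N + 1), ‖U.1 j 0‖ ^ k ∂ν = ∫ U : UG (N + 1), ‖U.1 0 0‖ ^ k ∂ν := by
  rw [← integral_mul_left_eq_self (fun U : UG (N + 1) => ‖U.1 0 0‖ ^ k)
    (permU (Equiv.swap 0 j))]
  simp only [permU_mul, Equiv.swap_apply_left]

lemma moment_two : ∫ U : UG (N + 1), ‖U.1 0 0‖ ^ 2 ∂ν = 1 / (N + 1) := by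
  have h : ∑ j, ∫ U : UG (N + 1), ‖U.1 j 0‖ ^ 2 ∂ν = 1 := by
    rw [← integral_finsetSum]
    · simp [col_sum]
    · exact fun j _ => int_cont ν ((norm_cont j).pow 2)
  simp only [moment_pow] at h
  simp at h
  field_simp
  linarith

lemma moment_z : ∫ U : UG (N + 1), U.1 0 0 ∂ν = 0 := by
  have h := integral_mul_left_eq_self (μ := ν) (fun U : UG (N + 1) => U.1 0 0) (iU (N + 1))
  simp only [iU_mul, integral_const_mul] at h
  have h2 : (Complex.I - 1) * ∫ U : UG (N + 1), U.1 0 0 ∂ν = 0 := by linear_combination h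
  rcases mul_eq_zero.mp h2 with h3 | h3
  · have := congrArg Complex.im h3; simp at this
  · exact h3

lemma moment_z2 : ∫ U : UG (N + 1), U.1 0 0 ^ 2 ∂ν = 0 := by
  have h := integral_mul_left_eq_self (μ := ν) (fun U : UG (N + 1) => U.1 0 0 ^ 2) (iU (N + 1))
  simp only [iU_mul, mul_pow, Complex.I_sq, integral_const_mul] at h
  linear_combination (-1 / 2) * h

end

lemma quartic_ineq (a b : ℂ) :
    ‖a + b‖ ^ 4 + ‖a - b‖ ^ 4 ≤ 2 * ‖a‖ ^ 4 + 2 * ‖b‖ ^ 4 + 12 * (‖a‖ ^ 2 * ‖b‖ ^ 2) := by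
  have h := parallelogram a b
  have h1 : ‖a + b‖ ^ 2 = ‖a‖ ^ 2 + 2 * inner ℝ a b + ‖b‖ ^ 2 := norm_add_sq_real a b
  have h2 : ‖a - b‖ ^ 2 = ‖a‖ ^ 2 - 2 * inner ℝ a b + ‖b‖ ^ 2 := norm_sub_sq_real a b
  have h3 : (inner ℝ a b) ^ 2 ≤ ‖a‖ ^ 2 * ‖b‖ ^ 2 := by
    rw [← mul_pow]
    exact sq_le_sq' (by linarith [neg_abs_le (inner ℝ a b), abs_real_inner_le_norm a b])
      (real_inner_le_norm a b)
  have e1 : ‖a + b‖ ^ 4 = (‖a‖ ^ 2 + 2 * inner ℝ a b + ‖b‖ ^ 2) ^ 2 := by rw [← h1]; ring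
  have e2 : ‖a - b‖ ^ 4 = (‖a‖ ^ 2 - 2 * inner ℝ a b + ‖b‖ ^ 2) ^ 2 := by rw [← h2]; ring
  rw [e1, e2]
  nlinarith

lemma moment_four_aux {N : ℕ} (ν : Measure (UG (N + 2))) [ν.IsHaarMeasure]
    [IsProbabilityMeasure ν] :
    ∫ U : UG (N + 2), ‖U.1 0 0‖ ^ 4 ∂ν ≤ 3 / ((N + 1) * (N + 2)) := by
  set a := ∫ U : UG (N + 2), ‖U.1 0 0‖ ^ 4 ∂ν with ha
  set b := ∫ U : UG (N + 2), ‖U.1 0 0‖ ^ 2 * ‖U.1 1 0‖ ^ 2 ∂ν with hb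
  have c0 := norm_cont (N := N + 1) 0
  have c1 := norm_cont (N := N + 1) 1
  have e0 := entry_continuous (N := N + 2) 0 0
  have e1 := entry_continuous (N := N + 2) 1 0
  -- a ≤ 3 b
  have h4 : ((√2)⁻¹ : ℝ) ^ 4 = 1 / 4 := by
    have h2 : ((√2)⁻¹ : ℝ) ^ 2 = 1 / 2 := by rw [inv_pow, Real.sq_sqrt (by norm_num)]; norm_num
    calc ((√2)⁻¹ : ℝ) ^ 4 = (((√2)⁻¹ : ℝ) ^ 2) ^ 2 := by ring
      _ = 1 / 4 := by rw [h2]; norm_num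
  have k0 : ∫ U : UG (N + 2), ‖U.1 0 0 + U.1 1 0‖ ^ 4 ∂ν = 4 * a := by
    have h := integral_mul_left_eq_self (μ := ν) (fun U : UG (N + 2) => ‖U.1 0 0‖ ^ 4) (hadU N)
    simp only [hadU_mul0, norm_mul, mul_pow, Complex.norm_real, Real.norm_eq_abs,
      abs_of_nonneg (inv_nonneg.mpr (Real.sqrt_nonneg 2)), h4, integral_const_mul] at h
    linarith
  have k1 : ∫ U : UG (N + 2), ‖U.1 0 0 - U.1 1 0‖ ^ 4 ∂ν = 4 * a := by
    have h := integral_mul_left_eq_self (μ := ν) (fun U : UG (N + 2) => ‖U.1 1 0‖ ^ 4) (hadU N)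
    simp only [hadU_mul1, norm_mul, mul_pow, Complex.norm_real, Real.norm_eq_abs,
      abs_of_nonneg (inv_nonneg.mpr (Real.sqrt_nonneg 2)), h4, integral_const_mul] at h
    rw [moment_pow ν 4 1] at h
    linarith
  have i1 : Integrable (fun U : UG (N + 2) => ‖U.1 0 0 + U.1 1 0‖ ^ 4) ν :=
    int_cont ν ((e0.add e1).norm.pow 4)
  have i2 : Integrable (fun U : UG (N + 2) => ‖U.1 0 0 - U.1 1 0‖ ^ 4) ν :=
    int_cont ν ((e0.sub e1).norm.pow 4)
  have i3 : Integrable (fun U : UG (N + 2) => 2 * ‖U.1 0 0‖ ^ 4) ν :=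
    int_cont ν ((c0.pow 4).const_mul 2)
  have i4 : Integrable (fun U : UG (N + 2) => 2 * ‖U.1 1 0‖ ^ 4) ν :=
    int_cont ν ((c1.pow 4).const_mul 2)
  have i5 : Integrable (fun U : UG (N + 2) => 12 * (‖U.1 0 0‖ ^ 2 * ‖U.1 1 0‖ ^ 2)) ν :=
    int_cont ν (((c0.pow 2).mul (c1.pow 2)).const_mul 12)
  have i34 : Integrable (fun U : UG (N + 2) => 2 * ‖U.1 0 0‖ ^ 4 + 2 * ‖U.1 1 0‖ ^ 4) ν :=
    i3.add i4
  have i0 : Integrable (fun U : UG (N + 2) => ‖U.1 0 0‖ ^ 4) ν := int_cont ν (c0.pow 4)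
  have hab : 8 * a ≤ 4 * a + 12 * b := by
    have := integral_mono (i1.add i2) ((i3.add i4).add i5)
      (fun U => quartic_ineq (U.1 0 0) (U.1 1 0))
    simp only [Pi.add_apply] at this
    rw [integral_add i1 i2, k0, k1, integral_add i34 i5, integral_add i3 i4,
      integral_const_mul, integral_const_mul, integral_const_mul, moment_pow ν 4 1,
      ← ha, ← hb] at this
    linarith
  -- a + (N+1) b = 1/(N+2)
  have hbj : ∀ j : Fin (N + 1),
      ∫ U : UG (N + 2), ‖U.1 0 0‖ ^ 2 * ‖U.1 j.succ 0‖ ^ 2 ∂ν = b := by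
    intro j
    rw [hb, ← integral_mul_left_eq_self (μ := ν)
      (fun U : UG (N + 2) => ‖U.1 0 0‖ ^ 2 * ‖U.1 1 0‖ ^ 2) (permU (Equiv.swap 1 j.succ))]
    have hs : Equiv.swap 1 j.succ 0 = (0 : Fin (N + 2)) :=
      Equiv.swap_apply_of_ne_of_ne (by simp) (Fin.succ_ne_zero j).symm
    simp only [permU_mul, Equiv.swap_apply_left, hs]
  have hsum : a + (N + 1) * b = 1 / (N + 2) := by
    have h2 := moment_two ν
    have h3 : ∀ U : UG (N + 2), ‖U.1 0 0‖ ^ 2 = ‖U.1 0 0‖ ^ 4 +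
        ∑ j : Fin (N + 1), ‖U.1 0 0‖ ^ 2 * ‖U.1 j.succ 0‖ ^ 2 := by
      intro U
      have := col_sum U
      rw [Fin.sum_univ_succ] at this
      rw [← Finset.mul_sum]
      linear_combination -‖U.1 0 0‖ ^ 2 * this
    have i6 : ∀ j : Fin (N + 1),
        Integrable (fun U : UG (N + 2) => ‖U.1 0 0‖ ^ 2 * ‖U.1 j.succ 0‖ ^ 2) ν :=
      fun j => int_cont ν ((c0.pow 2).mul ((norm_cont (N := N + 1) j.succ).pow 2))
    rw [integral_congr_ae (ae_of_all _ h3), integral_add i0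
      (integrable_finsetSum _ fun j _ => i6 j), integral_finsetSum _ (fun j _ => i6 j)] at h2
    simp only [hbj] at h2
    simp at h2
    rw [← ha] at h2
    rw [h2]; ring
  have ha0 : 0 ≤ a := integral_nonneg fun U => by positivity
  rw [le_div_iff₀ (by positivity)]
  rw [eq_div_iff (by positivity)] at hsum
  have hN : (0 : ℝ) ≤ N := Nat.cast_nonneg N
  have h5 : a * (N + 1) ≤ 3 * ((N + 1) * b) := by nlinarith
  nlinarith

lemma moment_four {N : ℕ} (ν : Measure (UG (N + 1))) [ν.IsHaarMeasure]
    [IsProbabilityMeasure ν] :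
    ∫ U : UG (N + 1), ‖U.1 0 0‖ ^ 4 ∂ν ≤ 6 / (N + 1) ^ 2 := by
  rcases N with _ | N
  · have : ∫ U : UG (0 + 1), ‖U.1 0 0‖ ^ 4 ∂ν ≤ ∫ U : UG (0 + 1), (1 : ℝ) ∂ν := by
      refine integral_mono (int_cont ν ((norm_cont 0).pow 4)) (integrable_const _) fun U => ?_
      exact pow_le_one₀ (norm_nonneg _) (U00_norm U.2)
    refine this.trans ?_
    simp
  · refine (moment_four_aux ν).trans ?_
    rw [div_le_div_iff₀ (by positivity) (by positivity)]
    push_cast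
    have hN : (0 : ℝ) ≤ N := Nat.cast_nonneg N
    nlinarith

lemma moment_three {N : ℕ} (ν : Measure (UG (N + 1))) [ν.IsHaarMeasure]
    [IsProbabilityMeasure ν] :
    ∫ U : UG (N + 1), ‖U.1 0 0‖ ^ 3 ∂ν ≤ 4 / ((N + 1) * √(N + 1)) := by
  set r := √((N : ℝ) + 1) with hr
  have hpos : 0 < r := Real.sqrt_pos.mpr (by positivity)
  have hr2 : r ^ 2 = (N : ℝ) + 1 := Real.sq_sqrt (by positivity)
  have c0 := norm_cont (N := N) 0
  have h1 : ∫ U : UG (N + 1), ‖U.1 0 0‖ ^ 3 ∂ν ≤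
      ∫ U : UG (N + 1), (r / 2 * ‖U.1 0 0‖ ^ 4 + 1 / (2 * r) * ‖U.1 0 0‖ ^ 2) ∂ν := by
    refine integral_mono (int_cont ν (c0.pow 3))
      (int_cont ν (((c0.pow 4).const_mul _).add ((c0.pow 2).const_mul _))) fun U => ?_
    have hx := norm_nonneg (U.1 0 0)
    set x := ‖U.1 0 0‖
    have : r / 2 * x ^ 4 + 1 / (2 * r) * x ^ 2 - x ^ 3 = x ^ 2 * (r * x - 1) ^ 2 / (2 * r) := by
      field_simp; ring
    have h0 : 0 ≤ x ^ 2 * (r * x - 1) ^ 2 / (2 * r) := by positivity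
    show x ^ 3 ≤ r / 2 * x ^ 4 + 1 / (2 * r) * x ^ 2
    linarith
  have j1 : Integrable (fun U : UG (N + 1) => r / 2 * ‖U.1 0 0‖ ^ 4) ν :=
    int_cont ν ((c0.pow 4).const_mul _)
  have j2 : Integrable (fun U : UG (N + 1) => 1 / (2 * r) * ‖U.1 0 0‖ ^ 2) ν :=
    int_cont ν ((c0.pow 2).const_mul _)
  rw [integral_add j1 j2,
    integral_const_mul, integral_const_mul, moment_two] at h1
  have h2 := moment_four ν
  have h3 := mul_le_mul_of_nonneg_left h2 (by positivity : 0 ≤ r / 2)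
  refine h1.trans ((add_le_add_left h3 _).trans ?_)
  rw [← hr2]
  have : r / 2 * (6 / (r ^ 2) ^ 2) + 1 / (2 * r) * (1 / r ^ 2) = (7 / 2) / (r ^ 2 * r) := by
    field_simp; ring
  rw [this]
  gcongr
  norm_num

end KS

namespace KS
open Set Topology Matrix

noncomputable def ip (t z : ℂ) : ℝ := t.re * z.re + t.im * z.im

lemma ip_add (t z w : ℂ) : ip t (z + w) = ip t z + ip t w := by
  simp [ip]; ring

lemma ip_sub (t z w : ℂ) : ip t (z - w) = ip t z - ip t w := by
  simp [ip]; ring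

lemma ip_eq (t z : ℂ) : ip t z = ((starRingEnd ℂ) t * z).re := by
  simp [ip]

lemma ip_le (t z : ℂ) : |ip t z| ≤ ‖t‖ * ‖z‖ := by
  rw [ip_eq]
  refine (Complex.abs_re_le_norm _).trans ?_
  simp

lemma ip_le' {t : ℂ} (ht : ‖t‖ ≤ 1) (z : ℂ) : |ip t z| ≤ ‖z‖ :=
  (ip_le t z).trans (mul_le_of_le_one_left (norm_nonneg _) ht)

lemma ch_eq (t z : ℂ) : ch t z = Complex.exp ((ip t z : ℝ) * Complex.I) := rfl

lemma exp_three {a : ℝ} (ha : |a| ≤ 1) :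
    ‖Complex.exp (a * Complex.I) - (1 + a * Complex.I - (a : ℂ) ^ 2 / 2)‖ ≤ |a| ^ 3 := by
  have hn : ‖(a : ℂ) * Complex.I‖ = |a| := by simp
  have h := Complex.exp_bound (x := (a : ℂ) * Complex.I) (by rw [hn]; exact ha) (n := 3) (by norm_num)
  rw [hn] at h
  have e : ∑ m ∈ Finset.range 3, ((a : ℂ) * Complex.I) ^ m / (m.factorial : ℂ) =
      1 + a * Complex.I - (a : ℂ) ^ 2 / 2 := by
    simp [Finset.sum_range_succ, Nat.factorial, mul_pow]
    ring
  rw [e] at h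
  refine h.trans ?_
  refine mul_le_of_le_one_right (by positivity) ?_
  norm_num [Nat.factorial]

noncomputable def mainT (t z : ℂ) : ℂ :=
  1 + ((ip t (-z - z ^ 2 / 2) : ℝ) : ℂ) * Complex.I - ((ip t z : ℝ) : ℂ) ^ 2 / 2

lemma log_two {z : ℂ} (hz : ‖z‖ ≤ 1 / 2) :
    ‖Complex.log (1 - z) - (-z - z ^ 2 / 2)‖ ≤ ‖z‖ ^ 3 := by
  have h := Complex.norm_log_sub_logTaylor_le 2 (z := -z) (by rw [norm_neg]; linarith)
  have e : Complex.logTaylor (2 + 1) (-z) = -z - z ^ 2 / 2 := by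
    simp [Complex.logTaylor_succ, Complex.logTaylor_zero]
    ring
  rw [e, ← sub_eq_add_neg, norm_neg] at h
  refine h.trans ?_
  have h2 : (1 - ‖z‖)⁻¹ ≤ 2 := by
    rw [inv_le_comm₀ (by linarith) (by norm_num)]; linarith
  have h0 : 0 ≤ ‖z‖ ^ 3 := by positivity
  have h3 := mul_le_mul_of_nonneg_left h2 h0
  norm_num
  linarith

lemma log_one {z : ℂ} (hz : ‖z‖ ≤ 1 / 2) :
    ‖Complex.log (1 - z) + z‖ ≤ ‖z‖ ^ 2 := by
  have h := Complex.norm_log_one_add_sub_self_le (z := -z) (by rw [norm_neg]; linarith)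
  rw [← sub_eq_add_neg, norm_neg, sub_neg_eq_add] at h
  refine h.trans ?_
  have h2 : (1 - ‖z‖)⁻¹ ≤ 2 := by
    rw [inv_le_comm₀ (by linarith) (by norm_num)]; linarith
  have h0 : 0 ≤ ‖z‖ ^ 2 := by positivity
  have h3 := mul_le_mul_of_nonneg_left h2 h0
  linarith

lemma pointwise {t z : ℂ} (ht : ‖t‖ ≤ 1) (hz : ‖z‖ ≤ 1) :
    ‖ch t (Complex.log (1 - z)) - mainT t z‖ ≤ 32 * ‖z‖ ^ 3 := by
  have hz0 := norm_nonneg z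
  by_cases h : ‖z‖ ≤ 1 / 2
  · set w := Complex.log (1 - z) with hw
    have hw1 : ‖w‖ ≤ 3 / 2 * ‖z‖ := by
      have := Complex.norm_log_one_add_half_le_self (z := -z) (by rwa [norm_neg])
      rwa [← sub_eq_add_neg, norm_neg] at this
    have ha : |ip t w| ≤ 3 / 2 * ‖z‖ := (ip_le' ht w).trans hw1
    have hc : |ip t z| ≤ ‖z‖ := ip_le' ht z
    have h1 := exp_three (a := ip t w) (by linarith)
    have h2 : |ip t w - ip t (-z - z ^ 2 / 2)| ≤ ‖z‖ ^ 3 := by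
      rw [← ip_sub]; exact (ip_le' ht _).trans (log_two h)
    have h3 : |ip t w + ip t z| ≤ ‖z‖ ^ 2 := by
      rw [← ip_add]; exact (ip_le' ht _).trans (log_one h)
    have h4 : |ip t w ^ 2 - ip t z ^ 2| ≤ ‖z‖ ^ 2 * (5 / 2 * ‖z‖) := by
      have : ip t w ^ 2 - ip t z ^ 2 = (ip t w + ip t z) * (ip t w - ip t z) := by ring
      rw [this, abs_mul]
      have h5 : |ip t w - ip t z| ≤ 5 / 2 * ‖z‖ := (abs_sub _ _).trans (by linarith)
      exact mul_le_mul h3 h5 (abs_nonneg _) (by positivity)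
    have e : ch t w - mainT t z =
        (Complex.exp (ip t w * Complex.I) - (1 + ip t w * Complex.I - (ip t w : ℂ) ^ 2 / 2))
        + ((ip t w - ip t (-z - z ^ 2 / 2) : ℝ) : ℂ) * Complex.I
        - ((ip t w ^ 2 - ip t z ^ 2 : ℝ) : ℂ) / 2 := by
      rw [ch_eq, mainT]; push_cast; ring
    rw [e]
    have n2 : ‖((ip t w - ip t (-z - z ^ 2 / 2) : ℝ) : ℂ) * Complex.I‖ ≤ ‖z‖ ^ 3 := by
      rw [norm_mul, Complex.norm_I, mul_one, Complex.norm_real]; exact h2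
    have n3 : ‖((ip t w ^ 2 - ip t z ^ 2 : ℝ) : ℂ) / 2‖ ≤ ‖z‖ ^ 2 * (5 / 2 * ‖z‖) := by
      rw [norm_div, Complex.norm_real, Complex.norm_ofNat, Real.norm_eq_abs]
      have := abs_nonneg (ip t w ^ 2 - ip t z ^ 2)
      linarith
    have n1 : |ip t w| ^ 3 ≤ (3 / 2 * ‖z‖) ^ 3 := pow_le_pow_left₀ (abs_nonneg _) ha 3
    refine (norm_sub_le _ _).trans ((add_le_add ((norm_add_le _ _).trans (add_le_add h1 n2)) n3).trans ?_)
    have h0 : 0 ≤ ‖z‖ ^ 3 := by positivity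
    nlinarith
  · push Not at h
    have h8 : 1 / 8 ≤ ‖z‖ ^ 3 := by
      have := pow_le_pow_left₀ (by norm_num) h.le 3
      norm_num at this ⊢; exact this
    have hc : |ip t z| ≤ 1 := (ip_le' ht z).trans hz
    have hz2 : ‖z ^ 2 / 2‖ ≤ 1 / 2 := by
      rw [norm_div, norm_pow, Complex.norm_ofNat]
      have : ‖z‖ ^ 2 ≤ 1 := pow_le_one₀ hz0 hz
      linarith
    have hd : |ip t (-z - z ^ 2 / 2)| ≤ 3 / 2 := by
      refine (ip_le' ht _).trans ((norm_sub_le _ _).trans ?_)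
      rw [norm_neg]; linarith
    have n1 : ‖((ip t (-z - z ^ 2 / 2) : ℝ) : ℂ) * Complex.I‖ ≤ 3 / 2 := by
      rw [norm_mul, Complex.norm_I, mul_one, Complex.norm_real]; exact hd
    have n2 : ‖((ip t z : ℝ) : ℂ) ^ 2 / 2‖ ≤ 1 / 2 := by
      rw [norm_div, norm_pow, Complex.norm_ofNat, Complex.norm_real, Real.norm_eq_abs]
      have : |ip t z| ^ 2 ≤ 1 := pow_le_one₀ (abs_nonneg _) hc
      linarith
    have n3 : ‖mainT t z‖ ≤ 3 := by
      refine (norm_sub_le _ _).trans ((add_le_add ((norm_add_le _ _).trans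
        (add_le_add_right n1 _)) n2).trans ?_)
      rw [norm_one]; norm_num
    refine (norm_sub_le _ _).trans ?_
    rw [ch_norm]
    linarith

lemma mainT_eq (t z : ℂ) : mainT t z = 1 + ((((-(starRingEnd ℂ) t) * z).re
      + ((-(starRingEnd ℂ) t / 2) * z ^ 2).re : ℝ) : ℂ) * Complex.I
      + (((-((starRingEnd ℂ) t) ^ 2 / 4) * z ^ 2).re - ‖t‖ ^ 2 / 4 * ‖z‖ ^ 2 : ℝ) := by
  have h1 : ip t (-z - z ^ 2 / 2) = ((-(starRingEnd ℂ) t) * z).re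
      + ((-(starRingEnd ℂ) t / 2) * z ^ 2).re := by
    rw [ip_eq, ← Complex.add_re]; congr 1; ring
  have h2 : -(ip t z) ^ 2 / 2 =
      ((-((starRingEnd ℂ) t) ^ 2 / 4) * z ^ 2).re - ‖t‖ ^ 2 / 4 * ‖z‖ ^ 2 := by
    have : (-((starRingEnd ℂ) t) ^ 2 / 4) * z ^ 2 = ((-1 / 4 : ℝ) : ℂ) * ((starRingEnd ℂ) t * z) ^ 2 := by
      push_cast; ring
    rw [this, Complex.re_ofReal_mul, Complex.sq_norm, Complex.sq_norm, Complex.normSq_apply,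
      Complex.normSq_apply, pow_two ((starRingEnd ℂ) t * z), Complex.mul_re ((starRingEnd ℂ) t * z)]
    simp [ip]
    ring
  rw [mainT, h1, ← h2]
  push_cast
  ring

lemma int_re {α : Type*} [MeasurableSpace α] (ν : Measure α) {f : α → ℂ} (hf : Integrable f ν)
    (h0 : ∫ x, f x ∂ν = 0) (c : ℂ) : ∫ x, (c * f x).re ∂ν = 0 := by
  have h1 := Complex.reCLM.integral_comp_comm (hf.const_mul c)
  simp only [Complex.reCLM_apply] at h1
  rw [h1, integral_const_mul, h0]; simp

lemma int_mainT {N : ℕ} (ν : Measure (UG (N + 1))) [ν.IsHaarMeasure] [IsProbabilityMeasure ν]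
    (t : ℂ) : ∫ U : UG (N + 1), mainT t (U.1 0 0) ∂ν = 1 - ((‖t‖ ^ 2 / (4 * (N + 1)) : ℝ) : ℂ) := by
  have ec := entry_continuous (N := N + 1) 0 0
  have i1 : Integrable (fun U : UG (N + 1) => U.1 0 0) ν := int_cont ν ec
  have i2 : Integrable (fun U : UG (N + 1) => U.1 0 0 ^ 2) ν := int_cont ν (ec.pow 2)
  have r1 : ∀ c : ℂ, Integrable (fun U : UG (N + 1) => (c * U.1 0 0).re) ν :=
    fun c => (i1.const_mul c).re
  have r2 : ∀ c : ℂ, Integrable (fun U : UG (N + 1) => (c * U.1 0 0 ^ 2).re) ν :=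
    fun c => (i2.const_mul c).re
  have i3 : Integrable (fun U : UG (N + 1) => ‖t‖ ^ 2 / 4 * ‖U.1 0 0‖ ^ 2) ν :=
    int_cont ν ((ec.norm.pow 2).const_mul _)
  have s1 : Integrable (fun U : UG (N + 1) => (-(starRingEnd ℂ) t * U.1 0 0).re
      + (-(starRingEnd ℂ) t / 2 * U.1 0 0 ^ 2).re) ν := (r1 _).add (r2 _)
  have s2 : Integrable (fun U : UG (N + 1) => (-((starRingEnd ℂ) t) ^ 2 / 4 * U.1 0 0 ^ 2).re
      - ‖t‖ ^ 2 / 4 * ‖U.1 0 0‖ ^ 2) ν := (r2 _).sub i3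
  have z1 : ∫ U : UG (N + 1), ((-(starRingEnd ℂ) t * U.1 0 0).re
      + (-(starRingEnd ℂ) t / 2 * U.1 0 0 ^ 2).re) ∂ν = 0 := by
    rw [integral_add (r1 _) (r2 _), int_re ν i1 (moment_z ν), int_re ν i2 (moment_z2 ν), add_zero]
  have z2 : ∫ U : UG (N + 1), ((-((starRingEnd ℂ) t) ^ 2 / 4 * U.1 0 0 ^ 2).re
      - ‖t‖ ^ 2 / 4 * ‖U.1 0 0‖ ^ 2) ∂ν = -(‖t‖ ^ 2 / (4 * (N + 1))) := by
    rw [integral_sub (r2 _) i3, int_re ν i2 (moment_z2 ν), integral_const_mul, moment_two]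
    field_simp
    ring
  have q1 : Integrable (fun U : UG (N + 1) => (1 : ℂ) + (((-(starRingEnd ℂ) t * U.1 0 0).re
      + (-(starRingEnd ℂ) t / 2 * U.1 0 0 ^ 2).re : ℝ) : ℂ) * Complex.I) ν :=
    (integrable_const _).add (s1.ofReal.mul_const _)
  have q2 : Integrable (fun U : UG (N + 1) => (((-(starRingEnd ℂ) t * U.1 0 0).re
      + (-(starRingEnd ℂ) t / 2 * U.1 0 0 ^ 2).re : ℝ) : ℂ) * Complex.I) ν :=
    s1.ofReal.mul_const _
  have q3 : Integrable (fun U : UG (N + 1) => (((-((starRingEnd ℂ) t) ^ 2 / 4 * U.1 0 0 ^ 2).re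
      - ‖t‖ ^ 2 / 4 * ‖U.1 0 0‖ ^ 2 : ℝ) : ℂ)) ν := s2.ofReal
  simp only [mainT_eq]
  rw [integral_add q1 q3, integral_add (integrable_const _) q2,
    integral_mul_const, integral_complex_ofReal, integral_complex_ofReal, z1, z2]
  simp
  ring

lemma psi_main {N : ℕ} (ν : Measure (UG (N + 1))) [ν.IsHaarMeasure] [IsProbabilityMeasure ν]
    {t : ℂ} (ht : ‖t‖ ≤ 1) :
    ‖psi ν t - Complex.exp (-(‖t‖ ^ 2 / (4 * (N + 1)) : ℝ))‖ ≤ 129 / ((N + 1) * √(N + 1)) := by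
  have ec := entry_continuous (N := N + 1) 0 0
  have m1 : Measurable (fun U : UG (N + 1) => ch t (Complex.log (1 - U.1 0 0))) :=
    (ch_continuous t).measurable.comp (Complex.measurable_log.comp (measurable_const.sub ec.measurable))
  have i1 : Integrable (fun U : UG (N + 1) => ch t (Complex.log (1 - U.1 0 0))) ν :=
    Integrable.of_bound m1.aestronglyMeasurable 1 (ae_of_all _ fun U => (ch_norm _ _).le)
  have i2 : Integrable (fun U : UG (N + 1) => mainT t (U.1 0 0)) ν := by
    refine int_cont ν ?_
    have : Continuous (mainT t) := by unfold mainT ip; fun_prop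
    exact this.comp ec
  have h1 : ‖psi ν t - (1 - ((‖t‖ ^ 2 / (4 * (N + 1)) : ℝ) : ℂ))‖ ≤ 128 / ((N + 1) * √(N + 1)) := by
    rw [← int_mainT ν t, psi, ← integral_sub i1 i2]
    refine (norm_integral_le_integral_norm _).trans ?_
    have : ∫ U : UG (N + 1), ‖ch t (Complex.log (1 - U.1 0 0)) - mainT t (U.1 0 0)‖ ∂ν
        ≤ ∫ U : UG (N + 1), 32 * ‖U.1 0 0‖ ^ 3 ∂ν :=
      integral_mono (i1.sub i2).norm (int_cont ν ((ec.norm.pow 3).const_mul 32))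
        fun U => pointwise ht (U00_norm U.2)
    refine this.trans ?_
    rw [integral_const_mul]
    have := mul_le_mul_of_nonneg_left (moment_three ν) (by norm_num : (0 : ℝ) ≤ 32)
    refine this.trans (le_of_eq ?_)
    ring
  set x : ℝ := ‖t‖ ^ 2 / (4 * (N + 1)) with hx
  have hn : (1 : ℝ) ≤ N + 1 := by have : (0 : ℝ) ≤ N := Nat.cast_nonneg N; linarith
  have hx0 : 0 ≤ x := by positivity
  have ht2 : ‖t‖ ^ 2 ≤ 1 := pow_le_one₀ (norm_nonneg _) ht
  have hx1 : x ≤ 1 / (N + 1) := by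
    rw [hx, div_le_div_iff₀ (by positivity) (by positivity)]
    nlinarith
  have hx1' : x ≤ 1 := hx1.trans (by rw [div_le_one (by positivity)]; exact hn)
  have h2 : ‖Complex.exp (-(x : ℝ)) - (1 - (x : ℂ))‖ ≤ 1 / ((N + 1) * √(N + 1)) := by
    have h3 : |Real.exp (-x) - 1 - (-x)| ≤ (-x) ^ 2 :=
      Real.abs_exp_sub_one_sub_id_le (by rwa [abs_neg, abs_of_nonneg hx0])
    have e : Complex.exp (-(x : ℝ)) - (1 - (x : ℂ)) = ((Real.exp (-x) - 1 - (-x) : ℝ) : ℂ) := by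
      push_cast; ring
    rw [e, Complex.norm_real]
    refine h3.trans ?_
    have hs : √((N : ℝ) + 1) ≤ N + 1 := Real.sqrt_le_iff.mpr ⟨by positivity, by nlinarith⟩
    have h4 : (-x) ^ 2 ≤ (1 / ((N : ℝ) + 1)) ^ 2 := by
      rw [neg_sq]; exact pow_le_pow_left₀ hx0 hx1 2
    refine h4.trans ?_
    rw [div_pow, one_pow, pow_two]
    gcongr
  have e : psi ν t - Complex.exp (-(x : ℝ)) = (psi ν t - (1 - (x : ℂ))) -
      (Complex.exp (-(x : ℝ)) - (1 - (x : ℂ))) := by ring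
  rw [e]
  refine (norm_sub_le _ _).trans ((add_le_add h1 h2).trans (le_of_eq ?_))
  ring

lemma psi_tendsto {N : ℕ} (ν : Measure (UG (N + 1))) [IsProbabilityMeasure ν] {τ : ℕ → ℂ}
    (hτ : Tendsto τ atTop (𝓝 0)) : Tendsto (fun n => psi ν (τ n)) atTop (𝓝 1) := by
  have ec := entry_continuous (N := N + 1) 0 0
  have h : Tendsto (fun n => psi ν (τ n)) atTop (𝓝 (∫ _ : UG (N + 1), (1 : ℂ) ∂ν)) := by
    refine tendsto_integral_of_dominated_convergence (fun _ => 1) (fun n => ?_)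
      (integrable_const _) (fun n => ae_of_all _ fun U => (ch_norm _ _).le) (ae_of_all _ fun U => ?_)
    · exact ((ch_continuous _).measurable.comp
        (Complex.measurable_log.comp (measurable_const.sub ec.measurable))).aestronglyMeasurable
    · have hc : Continuous (fun t : ℂ => ch t (Complex.log (1 - U.1 0 0))) := by
        unfold ch; fun_prop
      have := (hc.tendsto 0).comp hτ
      simpa [ch, Function.comp_def] using this
  simpa using h

end KS

namespace KS
open Set Topology Matrix

lemma norm_prod_sub (a b : ℕ → ℂ) (ha : ∀ k, ‖a k‖ ≤ 1) (hb : ∀ k, ‖b k‖ ≤ 1) (n : ℕ) :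
    ‖∏ k ∈ Finset.range n, a k - ∏ k ∈ Finset.range n, b k‖ ≤ ∑ k ∈ Finset.range n, ‖a k - b k‖ := by
  induction n with
  | zero => simp
  | succ n ih =>
    rw [Finset.prod_range_succ, Finset.prod_range_succ, Finset.sum_range_succ]
    have hA : ‖∏ k ∈ Finset.range n, a k‖ ≤ 1 := by
      rw [norm_prod]; exact Finset.prod_le_one (fun _ _ => norm_nonneg _) fun k _ => ha k
    set A := ∏ k ∈ Finset.range n, a k
    set B := ∏ k ∈ Finset.range n, b k
    have e : A * a n - B * b n = (A - B) * b n + A * (a n - b n) := by ring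
    rw [e]
    refine (norm_add_le _ _).trans (add_le_add ?_ ?_)
    · rw [norm_mul]; exact (mul_le_of_le_one_right (norm_nonneg _) (hb n)).trans ih
    · rw [norm_mul]; exact mul_le_of_le_one_left (norm_nonneg _) hA

lemma psi_norm {N : ℕ} (ν : Measure (UG (N + 1))) [IsProbabilityMeasure ν] (t : ℂ) :
    ‖psi ν t‖ ≤ 1 := by
  refine (norm_integral_le_integral_norm _).trans ?_
  simp [ch_norm]

lemma phi_prod (μ : ∀ N, Measure (UG N)) (h1 : ∀ N, (μ N).IsHaarMeasure)
    (h2 : ∀ N, IsProbabilityMeasure (μ N))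
    (hgood : ∀ N, ∀ᵐ U : UG N ∂(μ N), Matrix.det (1 - U.1) ≠ 0) (t : ℂ) (N : ℕ) :
    phi (μ N) t = ∏ k ∈ Finset.range N, psi (μ (k + 1)) t := by
  induction N with
  | zero => have := h2 0; simp [phi_zero]
  | succ N ih =>
    have := h1 N; have := h1 (N + 1); have := h2 N; have := h2 (N + 1)
    rw [phi_succ (μ N) (μ (N + 1)) (hgood (N + 1)), ih, Finset.prod_range_succ, mul_comm]

lemma summable_bd : Summable fun k : ℕ => (129 : ℝ) / ((k + 1) * √(k + 1)) := by
  have h := (summable_nat_add_iff 1).mpr (Real.summable_nat_rpow_inv (p := 3 / 2) |>.mpr (by norm_num))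
  refine (h.mul_left 129).congr fun k => ?_
  have hk : (0 : ℝ) < (k : ℝ) + 1 := by positivity
  push_cast
  rw [div_eq_mul_inv 129, Real.sqrt_eq_rpow]
  congr 2
  rw [show (3 / 2 : ℝ) = 1 + 1 / 2 by norm_num, Real.rpow_add hk, Real.rpow_one]

lemma sum_tendsto (μ : ∀ N, Measure (UG N)) (h1 : ∀ N, (μ N).IsHaarMeasure)
    (h2 : ∀ N, IsProbabilityMeasure (μ N)) {τ : ℕ → ℂ} (hτ : Tendsto τ atTop (𝓝 0)) :
    Tendsto (fun n => ∑ k ∈ Finset.range n, ‖psi (μ (k + 1)) (τ n) -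
      Complex.exp (-(‖τ n‖ ^ 2 / (4 * (k + 1)) : ℝ))‖) atTop (𝓝 0) := by
  classical
  have key : Tendsto (fun n => ∑' k, if k < n then ‖psi (μ (k + 1)) (τ n) -
      Complex.exp (-(‖τ n‖ ^ 2 / (4 * (k + 1)) : ℝ))‖ else 0) atTop (𝓝 (∑' _ : ℕ, (0 : ℝ))) := by
    refine tendsto_tsum_of_dominated_convergence summable_bd (fun k => ?_) ?_
    · have := h2 (k + 1)
      have a1 := psi_tendsto (μ (k + 1)) hτ
      have hc : Continuous fun t : ℂ => Complex.exp (-(‖t‖ ^ 2 / (4 * (k + 1)) : ℝ)) := by fun_prop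
      have a2 := (hc.tendsto 0).comp hτ
      have a3 := (a1.sub a2).norm
      simp only [Function.comp_def] at a3
      norm_num at a3
      refine a3.congr' ?_
      filter_upwards [eventually_gt_atTop k] with n hn
      rw [if_pos hn]
      norm_num
    · have : ∀ᶠ n in atTop, ‖τ n‖ ≤ 1 := by
        have := hτ.norm
        rw [norm_zero] at this
        exact this.eventually (eventually_le_nhds one_pos)
      filter_upwards [this] with n hn k
      have := h1 (k + 1)
      have := h2 (k + 1)
      split_ifs
      · rw [norm_norm]; exact psi_main (μ (k + 1)) hn
      · rw [norm_zero]; positivity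
  rw [tsum_zero] at key
  refine key.congr fun n => ?_
  rw [tsum_eq_sum (s := Finset.range n)]
  · exact Finset.sum_congr rfl fun k hk => by rw [if_pos (Finset.mem_range.mp hk)]
  · intro k hk
    rw [if_neg (by simpa using hk)]

noncomputable def sN (N : ℕ) : ℝ := Real.sqrt (1 / 2 * Real.log N)

lemma sN_nonneg (N : ℕ) : 0 ≤ sN N := Real.sqrt_nonneg _

lemma log_atTop : Tendsto (fun N : ℕ => Real.log N) atTop atTop :=
  Real.tendsto_log_atTop.comp tendsto_natCast_atTop_atTop

lemma sN_atTop : Tendsto sN atTop atTop :=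
  Real.tendsto_sqrt_atTop.comp (log_atTop.const_mul_atTop (by norm_num))

lemma harm_ratio : Tendsto (fun N : ℕ => (harmonic N : ℝ) / Real.log N) atTop (𝓝 1) := by
  have h := Real.tendsto_harmonic_sub_log.div_atTop log_atTop
  have h2 := h.add_const 1
  rw [zero_add] at h2
  refine h2.congr' ?_
  filter_upwards [log_atTop.eventually_gt_atTop 0] with N hN
  field_simp
  ring

lemma phi_tendsto (μ : ∀ N, Measure (UG N)) (h1 : ∀ N, (μ N).IsHaarMeasure)
    (h2 : ∀ N, IsProbabilityMeasure (μ N))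
    (hgood : ∀ N, ∀ᵐ U : UG N ∂(μ N), Matrix.det (1 - U.1) ≠ 0) (t : ℂ) :
    Tendsto (fun N => phi (μ N) (t / sN N)) atTop (𝓝 (Complex.exp (-(‖t‖ ^ 2 / 2 : ℝ)))) := by
  have hτ : Tendsto (fun N => t / (sN N : ℂ)) atTop (𝓝 0) := by
    rw [tendsto_zero_iff_norm_tendsto_zero]
    have := (tendsto_const_nhds (x := ‖t‖)).div_atTop sN_atTop
    refine this.congr fun N => ?_
    rw [norm_div, Complex.norm_real, Real.norm_of_nonneg (sN_nonneg N)]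
  have hs := sum_tendsto μ h1 h2 hτ
  have hd : Tendsto (fun N => phi (μ N) (t / sN N) -
      ∏ k ∈ Finset.range N, Complex.exp (-(‖t / (sN N : ℂ)‖ ^ 2 / (4 * (k + 1)) : ℝ)))
      atTop (𝓝 0) := by
    refine squeeze_zero_norm (fun N => ?_) hs
    rw [phi_prod μ h1 h2 hgood]
    refine norm_prod_sub (fun k => psi (μ (k + 1)) (t / (sN N : ℂ)))
      (fun k => Complex.exp (-(‖t / (sN N : ℂ)‖ ^ 2 / (4 * (k + 1)) : ℝ))) (fun k => ?_)
      (fun k => ?_) N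
    · have := h2 (k + 1); exact psi_norm _ _
    · rw [← Complex.ofReal_neg, Complex.norm_exp_ofReal]
      rw [Real.exp_le_one_iff, neg_nonpos]
      positivity
  have hp : Tendsto (fun N : ℕ => ∏ k ∈ Finset.range N,
      Complex.exp (-(‖t / (sN N : ℂ)‖ ^ 2 / (4 * (k + 1)) : ℝ))) atTop
      (𝓝 (Complex.exp (-(‖t‖ ^ 2 / 2 : ℝ)))) := by
    have hr : Tendsto (fun N : ℕ => Complex.exp (-(‖t‖ ^ 2 / 2 * ((harmonic N : ℝ) / Real.log N) : ℝ)))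
        atTop (𝓝 (Complex.exp (-(‖t‖ ^ 2 / 2 : ℝ)))) := by
      have hc : Continuous fun x : ℝ => Complex.exp (-(‖t‖ ^ 2 / 2 * x : ℝ)) := by fun_prop
      have := (hc.tendsto 1).comp harm_ratio
      rw [mul_one] at this
      exact this
    refine hr.congr' ?_
    filter_upwards [log_atTop.eventually_gt_atTop 0] with N hN
    rw [← Complex.exp_sum]
    congr 1
    rw [Finset.sum_neg_distrib, ← Complex.ofReal_sum]
    congr 2
    have hsq : sN N ^ 2 = 1 / 2 * Real.log N := Real.sq_sqrt (by positivity)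
    rw [norm_div, Complex.norm_real, Real.norm_of_nonneg (sN_nonneg N), div_pow, hsq,
      harmonic]
    push_cast
    rw [mul_div_assoc', Finset.mul_sum, Finset.sum_div]
    refine Finset.sum_congr rfl fun k _ => ?_
    field_simp
    ring
  have := hd.add hp
  simpa using this

/-- The limiting measure on the plane. -/
noncomputable def gaussC : Measure ℂ :=
  ((gaussianReal 0 1).prod (gaussianReal 0 1)).map fun p : ℝ × ℝ => (p.1 : ℂ) + p.2 * Complex.I

instance : IsProbabilityMeasure gaussC :=
  Measure.isProbabilityMeasure_map (by fun_prop)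

lemma charFun_gaussC (t : ℂ) : charFun gaussC t = Complex.exp (-(‖t‖ ^ 2 / 2 : ℝ)) := by
  rw [charFun_apply, gaussC, integral_map (by fun_prop) (by fun_prop)]
  have e : ∀ p : ℝ × ℝ, Complex.exp ((inner ℝ ((p.1 : ℂ) + p.2 * Complex.I) t : ℝ) * Complex.I) =
      Complex.exp (t.re * p.1 * Complex.I) * Complex.exp (t.im * p.2 * Complex.I) := by
    intro p
    rw [← Complex.exp_add]
    congr 1
    simp [Complex.inner]
    ring
  simp only [e]
  rw [integral_prod_mul (fun x : ℝ => Complex.exp (t.re * x * Complex.I))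
    (fun x : ℝ => Complex.exp (t.im * x * Complex.I)), ← charFun_apply_real, ← charFun_apply_real,
    charFun_gaussianReal, charFun_gaussianReal, ← Complex.exp_add, Complex.sq_norm,
    Complex.normSq_apply]
  congr 1
  push_cast
  ring

lemma charFun_scaled {N : ℕ} (μ : Measure (UG N)) (s : ℝ) (t : ℂ) :
    charFun (μ.map fun U : UG N => Lfun U.1 / (s : ℂ)) t = phi μ (t / s) := by
  rw [charFun_apply, integral_map (Lfun_measurable.div_const _).aemeasurable (by fun_prop), phi]
  congr 1
  funext U
  rw [ch]
  congr 2
  simp only [Complex.inner, Complex.div_ofReal_re, Complex.div_ofReal_im, Complex.mul_re,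
    Complex.conj_re, Complex.conj_im]
  push_cast
  ring

lemma main_limit (μ : ∀ N, Measure (UG N)) (h1 : ∀ N, (μ N).IsHaarMeasure)
    (h2 : ∀ N, IsProbabilityMeasure (μ N))
    (hgood : ∀ N, ∀ᵐ U : UG N ∂(μ N), Matrix.det (1 - U.1) ≠ 0)
    (f : BoundedContinuousFunction (ℝ × ℝ) ℝ) :
    Tendsto (fun N => ∫ U : UG N, f ((Lfun U.1).re / sN N, (Lfun U.1).im / sN N) ∂(μ N)) atTop
      (𝓝 (∫ p, f p ∂((gaussianReal 0 1).prod (gaussianReal 0 1)))) := by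
  have hm : ∀ N, Measurable fun U : UG N => Lfun U.1 / (sN N : ℂ) :=
    fun N => Lfun_measurable.div_const _
  have hpm : ∀ N, IsProbabilityMeasure ((μ N).map fun U : UG N => Lfun U.1 / (sN N : ℂ)) :=
    fun N => by have := h2 N; exact Measure.isProbabilityMeasure_map (hm N).aemeasurable
  let m : ℕ → ProbabilityMeasure ℂ := fun N => ⟨_, hpm N⟩
  let g : ProbabilityMeasure ℂ := ⟨gaussC, inferInstance⟩
  have hlim : Tendsto m atTop (𝓝 g) := by
    refine ProbabilityMeasure.tendsto_of_tendsto_charFun fun t => ?_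
    show Tendsto (fun N => charFun ((μ N).map fun U : UG N => Lfun U.1 / (sN N : ℂ)) t) atTop
      (𝓝 (charFun gaussC t))
    simp only [charFun_scaled, charFun_gaussC]
    exact phi_tendsto μ h1 h2 hgood t
  rw [ProbabilityMeasure.tendsto_iff_forall_integral_tendsto] at hlim
  have hF : Continuous fun z : ℂ => (z.re, z.im) := by fun_prop
  have hfF : Continuous fun z : ℂ => f (z.re, z.im) := f.continuous.comp hF
  have h := hlim (f.compContinuous ⟨_, hF⟩)
  have e1 : ∀ N, ∫ z, (f.compContinuous ⟨_, hF⟩) z ∂(m N : Measure ℂ) =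
      ∫ U : UG N, f ((Lfun U.1).re / sN N, (Lfun U.1).im / sN N) ∂(μ N) := by
    intro N
    show ∫ z, f (z.re, z.im) ∂((μ N).map fun U : UG N => Lfun U.1 / (sN N : ℂ)) = _
    rw [integral_map (hm N).aemeasurable hfF.aestronglyMeasurable]
    simp only [Complex.div_ofReal_re, Complex.div_ofReal_im]
  have e2 : ∫ z, (f.compContinuous ⟨_, hF⟩) z ∂(g : Measure ℂ) =
      ∫ p, f p ∂((gaussianReal 0 1).prod (gaussianReal 0 1)) := by
    show ∫ z, f (z.re, z.im) ∂gaussC = _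
    rw [gaussC, integral_map (by fun_prop) hfF.aestronglyMeasurable]
    simp
  simp only [e1] at h
  rw [e2] at h
  exact h

end KS

/-- Keating–Snaith central limit theorem.  For each `N`, `V N` is Haar
distributed on `U(N)` and `L N ω` is `log Z_N`, the value at `x = 1` of the continuous
branch of `x ↦ log det(I - x V ω)` on `[0,1]` vanishing at `0`.  Then
`(Re log Z_N, Im log Z_N)/√((1/2) log N)` converges in distribution (i.e. the integrals of
every bounded continuous test function converge) to a pair of independent standard
Gaussians, whose joint law is the product measure `N(0,1) ⊗ N(0,1)` on `ℝ²`. -/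
theorem statement10
    (Ω : ℕ → Type*) [∀ N, MeasurableSpace (Ω N)] (P : ∀ N, Measure (Ω N))
    (hP : ∀ N, IsProbabilityMeasure (P N))
    (μ : ∀ N, Measure (Matrix.unitaryGroup (Fin N) ℂ))
    (hμ : ∀ N, (μ N).IsHaarMeasure ∧ IsProbabilityMeasure (μ N))
    (V : ∀ N, Ω N → Matrix.unitaryGroup (Fin N) ℂ)
    (hV : ∀ N, Measure.map (V N) (P N) = μ N)
    (L : ∀ N, Ω N → ℂ)
    (hL : ∀ N, ∀ ω, ∃ g : ℝ → ℂ, ContinuousOn g (Set.Icc 0 1) ∧ g 0 = 0 ∧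
      (∀ x ∈ Set.Icc (0 : ℝ) 1,
        Complex.exp (g x) = Matrix.det (1 - (x : ℂ) • (V N ω : Matrix (Fin N) (Fin N) ℂ))) ∧
      L N ω = g 1) :
    ∀ f : BoundedContinuousFunction (ℝ × ℝ) ℝ,
      Tendsto
        (fun N => ∫ ω, f ((L N ω).re / Real.sqrt (1 / 2 * Real.log N),
          (L N ω).im / Real.sqrt (1 / 2 * Real.log N)) ∂(P N))
        atTop
        (nhds (∫ p, f p ∂((gaussianReal 0 1).prod (gaussianReal 0 1)))) := by
  intro f
  have hVm : ∀ N, AEMeasurable (V N) (P N) := by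
    intro N
    by_contra h
    have h0 := Measure.map_of_not_aemeasurable h
    rw [hV N] at h0
    have := (hμ N).2
    exact IsProbabilityMeasure.ne_zero (μ N) h0
  have hLL : ∀ N ω, L N ω = KS.Lfun (V N ω).1 := by
    intro N ω
    obtain ⟨g, hg1, hg2, hg3, hg4⟩ := hL N ω
    have : KS.IsLift (KS.dpath (V N ω).1) g := ⟨hg1, hg2, hg3⟩
    rw [hg4, KS.Lfun_eq this]
  have hgood : ∀ N, ∀ᵐ U : KS.UG N ∂(μ N), Matrix.det (1 - U.1) ≠ 0 := by
    intro N
    rw [← hV N]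
    have hc : Continuous fun U : KS.UG N => Matrix.det (1 - U.1) :=
      (continuous_const.sub continuous_subtype_val).matrix_det
    refine (ae_map_iff (hVm N) ?_).mpr (ae_of_all _ fun ω => ?_)
    · exact (isOpen_ne.preimage hc).measurableSet
    · obtain ⟨g, hg1, hg2, hg3, hg4⟩ := hL N ω
      have := hg3 1 (by simp)
      rw [Complex.ofReal_one, one_smul] at this
      rw [← this]
      exact Complex.exp_ne_zero _
  have h := KS.main_limit μ (fun N => (hμ N).1) (fun N => (hμ N).2) hgood f
  refine h.congr fun N => ?_
  rw [← hV N, integral_map (hVm N)]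
  · simp only [hLL]; rfl
  · refine Measurable.aestronglyMeasurable ?_
    refine f.continuous.measurable.comp (Measurable.prodMk ?_ ?_)
    · exact (Complex.measurable_re.comp KS.Lfun_measurable).div_const _
    · exact (Complex.measurable_im.comp KS.Lfun_measurable).div_const _
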